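/- arXiv:2310.19437 — 3 statements merged into one kernel-verified Lean document; each statement's English description precedes it below -/
import Mathlib

section
/- Let t be an edge labeling of K_n (n ≥ 2), let p ≥ 1 be an integer and m a real number. If Σ_{u∈V(K_n)} (|U_+(t,u)| + |U_−(t,u)|) ≤ n·m, then there exist two distinct vertices u and v such that |U_+(t,u)| + |U_−(t,v)| + 2|B({u,v})| ≤ m + 16. -/
open Finset

namespace Swap

noncomputable section
open scoped Classical

def eps (n : ℕ) : ℕ := n * (n - 1) / 2

def incEdges (n : ℕ) (v : Fin n) : Finset (Sym2 (Fin n)) :=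
  Finset.univ.filter fun e => v ∈ e ∧ ¬ e.IsDiag

def IsEdgeLabeling (n : ℕ) (t : Sym2 (Fin n) → ℕ) : Prop :=
  Set.BijOn t {e : Sym2 (Fin n) | ¬ e.IsDiag} (Set.Icc 1 (eps n))

def labelSum (n : ℕ) (t : Sym2 (Fin n) → ℕ) (v : Fin n) : ℤ :=
  ∑ e ∈ incEdges n v, (t e : ℤ)

def labelSet (n : ℕ) (t : Sym2 (Fin n) → ℕ) (v : Fin n) : Finset ℕ :=
  (incEdges n v).image t

def AlmostSupermagic (n α : ℕ) (t : Sym2 (Fin n) → ℕ) : Prop :=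
  IsEdgeLabeling n t ∧ ∀ u v : Fin n, |labelSum n t u - labelSum n t v| ≤ (α : ℤ)

def IsPSwap (n p : ℕ) (t t' : Sym2 (Fin n) → ℕ) : Prop :=
  IsEdgeLabeling n t' ∧ ∀ e : Sym2 (Fin n), ¬ e.IsDiag → |(t' e : ℤ) - (t e : ℤ)| ≤ (p : ℤ)

def robustness (n p : ℕ) (t : Sym2 (Fin n) → ℕ) : ℕ :=
  sSup {d : ℕ | ∃ t' : Sym2 (Fin n) → ℕ, IsPSwap n p t t' ∧
    ∃ u v : Fin n, u ≠ v ∧ (d : ℤ) = |labelSum n t' u - labelSum n t' v|}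

def Uplus (n p : ℕ) (t : Sym2 (Fin n) → ℕ) (v : Fin n) : Finset (Sym2 (Fin n)) :=
  (incEdges n v).filter fun e => ∃ e' ∈ incEdges n v, t e' = t e + p

def Uminus (n p : ℕ) (t : Sym2 (Fin n) → ℕ) (v : Fin n) : Finset (Sym2 (Fin n)) :=
  (incEdges n v).filter fun e => ∃ e' ∈ incEdges n v, t e' + p = t e

def badPairsI (n p : ℕ) (t : Sym2 (Fin n) → ℕ) (u v : Fin n) :
    Finset (Sym2 (Sym2 (Fin n))) :=
  Finset.univ.filter fun P => ∃ e₁ e₂ : Sym2 (Fin n), P = s(e₁, e₂) ∧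
    ¬ e₁.IsDiag ∧ ¬ e₂.IsDiag ∧ u ∈ e₁ ∧ v ∈ e₂ ∧ ((t e₁ : ℤ) - (t e₂ : ℤ)).natAbs = p

def badPairsII (n p : ℕ) (t : Sym2 (Fin n) → ℕ) (u v : Fin n) :
    Finset (Sym2 (Sym2 (Fin n))) :=
  Finset.univ.filter fun P => ∃ e₁ e₂ : Sym2 (Fin n), P = s(e₁, e₂) ∧
    ¬ e₁.IsDiag ∧ ¬ e₂.IsDiag ∧ u ∈ e₁ ∧ v ∈ e₂ ∧ ((t e₁ : ℤ) - (t e₂ : ℤ)).natAbs = 2 * p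

def badPairs (n p : ℕ) (t : Sym2 (Fin n) → ℕ) (u v : Fin n) :
    Finset (Sym2 (Sym2 (Fin n))) :=
  badPairsI n p t u v ∪ badPairsII n p t u v

def IsAP1 (I : Finset ℕ) : Prop := ∃ a b : ℕ, a ≤ b ∧ I = Finset.Icc a b

def SetHasType (p m ℓ : ℕ) (S : Finset ℕ) : Prop :=
  ∃ 𝒜 : Finset (Finset ℕ), 𝒜.card ≤ m ∧
    (∀ I ∈ 𝒜, IsAP1 I ∧ I ⊆ S ∧ 2 * p ≤ I.card) ∧
    (𝒜 : Set (Finset ℕ)).PairwiseDisjoint id ∧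
    ℓ ≤ ∑ I ∈ 𝒜, I.card

def LabelingHasType (n p m ℓ : ℕ) (t : Sym2 (Fin n) → ℕ) : Prop :=
  ∀ v : Fin n, SetHasType p m ℓ (labelSet n t v)

def AstrayGood (n b : ℕ) (t : Sym2 (Fin n) → ℕ) : Prop :=
  IsEdgeLabeling n t ∧
  ∃ A : Finset (Sym2 (Fin n)), (∀ e ∈ A, ¬ e.IsDiag) ∧
    A.card % 2 = eps n % 2 ∧
    A.image t = Finset.Icc ((eps n - A.card) / 2 + 1) ((eps n + A.card) / 2) ∧
    ∀ v : Fin n,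
      (incEdges n v ∩ A).card ≤ b ∧
      ((incEdges n v).filter fun e => t e ≤ (eps n - A.card) / 2).card
        = ((incEdges n v).filter fun e => (eps n + A.card) / 2 < t e).card ∧
      2 * ∑ e ∈ incEdges n v \ A, t e = (incEdges n v \ A).card * (eps n + 1)

def Admissible (p : ℕ → ℕ) : Prop :=
  Filter.Tendsto (fun n => (p n : ℝ) / n) Filter.atTop (nhds 0) ∧
  Filter.Tendsto p Filter.atTop Filter.atTop

end
end Swap


namespace SwapAux
open Swap Classical

noncomputable def E (n : ℕ) : Finset (Sym2 (Fin n)) :=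
  Finset.univ.filter fun e => ¬ e.IsDiag

lemma two_card_E (n : ℕ) : 2 * (E n).card = n * (n - 1) := by
  have h := Sym2.card_subtype_not_diag (α := Fin n)
  rw [Fintype.card_subtype, Fintype.card_fin, Nat.choose_two_right] at h
  have h2 : (E n).card = n * (n - 1) / 2 := by
    rw [← h]; unfold E; congr!
  rw [h2]
  exact Nat.mul_div_cancel' (Nat.even_mul_pred_self n).two_dvd

def close (p a b : ℕ) : Prop :=
  ((a : ℤ) - (b : ℤ)).natAbs = p ∨ ((a : ℤ) - (b : ℤ)).natAbs = 2 * p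

noncomputable def Q (n p : ℕ) (t : Sym2 (Fin n) → ℕ) :
    Finset (Sym2 (Fin n) × Sym2 (Fin n)) :=
  (E n ×ˢ E n).filter fun q => close p (t q.1) (t q.2)

lemma card_close (n p : ℕ) (t : Sym2 (Fin n) → ℕ) (ht : IsEdgeLabeling n t)
    (e : Sym2 (Fin n)) : ((E n).filter fun f => close p (t e) (t f)).card ≤ 4 := by
  have hle : ((E n).filter fun f => close p (t e) (t f)).card ≤
      ({(t e : ℤ) + p, (t e : ℤ) - p, (t e : ℤ) + 2 * p, (t e : ℤ) - 2 * p} : Finset ℤ).card := by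
    apply Finset.card_le_card_of_injOn (fun f => (t f : ℤ))
    · intro f hf
      have hf' := (Finset.mem_filter.mp (Finset.mem_coe.mp hf)).2
      simp only [close] at hf'
      simp only [Finset.coe_insert, Finset.coe_singleton, Set.mem_insert_iff,
        Set.mem_singleton_iff]
      omega
    · intro f hf g hg hfg
      have hf' := (Finset.mem_filter.mp (Finset.mem_filter.mp (Finset.mem_coe.mp hf)).1).2
      have hg' := (Finset.mem_filter.mp (Finset.mem_filter.mp (Finset.mem_coe.mp hg)).1).2
      have hfg' : (t f : ℤ) = (t g : ℤ) := hfg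
      exact ht.injOn hf' hg' (by exact_mod_cast hfg')
  exact hle.trans Finset.card_le_four

lemma card_Q (n p : ℕ) (t : Sym2 (Fin n) → ℕ) (ht : IsEdgeLabeling n t) :
    (Q n p t).card ≤ 4 * (E n).card := by
  have : (Q n p t).card = ∑ e ∈ E n, ((E n).filter fun f => close p (t e) (t f)).card := by
    simp only [Q, Finset.card_filter, Finset.sum_product]
  rw [this]
  calc _ ≤ ∑ e ∈ E n, 4 := Finset.sum_le_sum fun e _ => card_close n p t ht e
    _ = _ := by simp [mul_comm]

lemma card_mem (n : ℕ) (e : Sym2 (Fin n)) :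
    ∑ u : Fin n, (if u ∈ e then 1 else 0) ≤ 2 := by
  induction e using Sym2.ind with
  | _ a b =>
    rw [← Finset.card_filter]
    refine (Finset.card_le_card (t := {a, b}) ?_).trans Finset.card_le_two
    intro x hx
    simpa using hx

lemma card_bad (n p : ℕ) (t : Sym2 (Fin n) → ℕ) (u v : Fin n) :
    (badPairs n p t u v).card ≤ ((Q n p t).filter fun q => u ∈ q.1 ∧ v ∈ q.2).card := by
  refine (Finset.card_le_card (t := ((Q n p t).filter fun q => u ∈ q.1 ∧ v ∈ q.2).image
    fun q => s(q.1, q.2)) ?_).trans Finset.card_image_le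
  intro P hP
  simp only [badPairs, badPairsI, badPairsII, Finset.mem_union, Finset.mem_filter,
    Finset.mem_univ, true_and] at hP
  simp only [Finset.mem_image, Finset.mem_filter, Q, E, Finset.mem_product,
    Finset.mem_univ, true_and]
  rcases hP with ⟨a, b, rfl, ha, hb, hu, hv, h⟩ | ⟨a, b, rfl, ha, hb, hu, hv, h⟩
  · exact ⟨(a, b), ⟨⟨⟨ha, hb⟩, Or.inl h⟩, hu, hv⟩, rfl⟩
  · exact ⟨(a, b), ⟨⟨⟨ha, hb⟩, Or.inr h⟩, hu, hv⟩, rfl⟩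

lemma sum_bad (n p : ℕ) (t : Sym2 (Fin n) → ℕ) (ht : IsEdgeLabeling n t) :
    ∑ u : Fin n, ∑ v : Fin n, (badPairs n p t u v).card ≤ 8 * (n * (n - 1)) := by
  calc _ ≤ ∑ u : Fin n, ∑ v : Fin n,
        ((Q n p t).filter fun q => u ∈ q.1 ∧ v ∈ q.2).card :=
        Finset.sum_le_sum fun u _ => Finset.sum_le_sum fun v _ => card_bad n p t u v
    _ = ∑ u : Fin n, ∑ v : Fin n, ∑ q ∈ Q n p t,
        (if u ∈ q.1 then 1 else 0) * (if v ∈ q.2 then 1 else 0) := by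
        refine Finset.sum_congr rfl fun u _ => Finset.sum_congr rfl fun v _ => ?_
        rw [Finset.card_filter]
        refine Finset.sum_congr rfl fun q _ => ?_
        by_cases h1 : u ∈ q.1 <;> by_cases h2 : v ∈ q.2 <;> simp [h1, h2]
    _ = ∑ q ∈ Q n p t, (∑ u : Fin n, if u ∈ q.1 then 1 else 0) *
          (∑ v : Fin n, if v ∈ q.2 then 1 else 0) := by
        simp_rw [Finset.sum_mul_sum]
        rw [Finset.sum_comm (s := Q n p t)]
        refine Finset.sum_congr rfl fun u _ => ?_
        rw [Finset.sum_comm]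
    _ ≤ ∑ q ∈ Q n p t, 2 * 2 :=
        Finset.sum_le_sum fun q _ => Nat.mul_le_mul (card_mem n _) (card_mem n _)
    _ ≤ _ := by
        have h1 := card_Q n p t ht
        have h2 := two_card_E n
        simp only [Finset.sum_const, smul_eq_mul]
        omega

end SwapAux

theorem stmt2 (n p : ℕ) (hn : 2 ≤ n) (hp : 1 ≤ p) (m : ℝ)
    (t : Sym2 (Fin n) → ℕ) (ht : Swap.IsEdgeLabeling n t)
    (h : (∑ u : Fin n, ((Swap.Uplus n p t u).card + (Swap.Uminus n p t u).card) : ℝ) ≤ n * m) :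
    ∃ u v : Fin n, u ≠ v ∧
      ((Swap.Uplus n p t u).card + (Swap.Uminus n p t v).card
        + 2 * (Swap.badPairs n p t u v).card : ℝ) ≤ m + 16 := by
  by_contra! hcon
  have hB := SwapAux.sum_bad n p t ht
  set a : Fin n → ℝ := fun u => ((Swap.Uplus n p t u).card : ℝ) with ha
  set b : Fin n → ℝ := fun u => ((Swap.Uminus n p t u).card : ℝ) with hb
  set B : Fin n → Fin n → ℝ := fun u v => ((Swap.badPairs n p t u v).card : ℝ) with hBd
  have hB' : ∑ u, ∑ v, B u v ≤ 8 * (n * ((n : ℝ) - 1)) := by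
    have h1 : ((n - 1 : ℕ) : ℝ) = (n : ℝ) - 1 := by
      rw [Nat.cast_sub (by omega)]; simp
    rw [← h1]
    simp only [hBd]
    exact_mod_cast hB
  have hS : ∑ u, a u + ∑ u, b u ≤ n * m := by
    rw [← Finset.sum_add_distrib]; exact h
  have hn' : (2 : ℝ) ≤ n := by exact_mod_cast hn
  -- pointwise inequality, with the diagonal corrected
  have key : ∑ u : Fin n, ∑ v : Fin n, (m + 16 + (if u = v then a u + b u - (m + 16) else 0))
      < ∑ u : Fin n, ∑ v : Fin n, (a u + b v + 2 * B u v) := by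
    have hpt : ∀ u v : Fin n, (m + 16 + (if u = v then a u + b u - (m + 16) else 0))
        ≤ a u + b v + 2 * B u v := by
      intro u v
      by_cases huv : u = v
      · subst huv
        have : 0 ≤ B u u := Nat.cast_nonneg _
        simp; linarith
      · have := hcon u v huv
        simp only [if_neg huv]; simp only [ha, hb, hBd]; linarith
    have h01 : (⟨0, by omega⟩ : Fin n) ≠ ⟨1, by omega⟩ := by simp
    refine Finset.sum_lt_sum (fun u _ => Finset.sum_le_sum fun v _ => hpt u v)
      ⟨⟨0, by omega⟩, Finset.mem_univ _, ?_⟩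
    refine Finset.sum_lt_sum (fun v _ => hpt _ v) ⟨⟨1, by omega⟩, Finset.mem_univ _, ?_⟩
    have := hcon _ _ h01
    rw [if_neg h01]; simp only [ha, hb, hBd]; linarith
  simp only [Finset.sum_add_distrib, Finset.sum_ite_eq, Finset.mem_univ, if_true,
    Finset.sum_sub_distrib, Finset.sum_const, Finset.card_univ, Fintype.card_fin,
    nsmul_eq_mul, ← Finset.mul_sum] at key
  nlinarith [mul_le_mul_of_nonneg_left hS (by linarith : (0 : ℝ) ≤ (n : ℝ) - 1)]
end

section
/- For every integer q ≥ 2 there exists a 1-astray good edge labeling T of K_{8q} such that for every positive integer p with 2p ≤ q, the labeling T is of (2, 2q)_p type. -/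
open Finset

namespace SwapAux

/-- a tournament on four vertices with all indegrees even and all outdegrees positive -/
def inner (c d : Fin 4) : Bool :=
  match c.val, d.val with
  | 0, 1 => true
  | 0, 2 => true
  | 0, 3 => true
  | 1, 2 => true
  | 2, 3 => true
  | 3, 1 => true
  | _, _ => false

def beat {q : ℕ} (x y : Fin q × Fin 4) : Bool :=
  if x.1 = y.1 then inner x.2 y.2
  else if x.1 < y.1 then decide ((x.2.val + y.2.val) % 2 = 0)
  else decide ((x.2.val + y.2.val) % 2 = 1)

theorem beat_irrefl {q : ℕ} (x : Fin q × Fin 4) : beat x x = false := by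
  unfold beat
  rw [if_pos rfl]
  generalize x.2 = c
  revert c; decide

theorem beat_anti {q : ℕ} (x y : Fin q × Fin 4) (h : x ≠ y) : beat x y = !beat y x := by
  obtain ⟨m, c⟩ := x
  obtain ⟨m', d⟩ := y
  unfold beat
  simp only
  rcases lt_trichotomy m m' with h1 | h1 | h1
  · rw [if_neg h1.ne, if_pos h1, if_neg h1.ne', if_neg (not_lt.2 h1.le)]
    have A : (c.val + d.val) % 2 = 0 ∨ (c.val + d.val) % 2 = 1 := by omega
    rcases A with A | A <;> simp [A, add_comm d.val c.val]
  · subst h1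
    have h2 : c ≠ d := fun h2 => h (by rw [h2])
    rw [if_pos rfl, if_pos rfl]
    clear h
    revert c d; decide
  · rw [if_neg h1.ne', if_neg (not_lt.2 h1.le), if_neg h1.ne, if_pos h1]
    have A : (c.val + d.val) % 2 = 0 ∨ (c.val + d.val) % 2 = 1 := by omega
    rcases A with A | A <;> simp [A, add_comm d.val c.val]

theorem beat_even {q : ℕ} (y : Fin q × Fin 4) :
    Even (Finset.univ.filter fun x : Fin q × Fin 4 => beat x y = true).card := by
  rw [Finset.card_filter, Fintype.sum_prod_type]
  apply Finset.even_sum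
  intro m _
  rw [← Finset.card_filter]
  obtain ⟨m', d⟩ := y
  unfold beat
  simp only
  rcases lt_trichotomy m m' with h1 | h1 | h1
  · simp only [if_neg h1.ne, if_pos h1]
    have A : ∀ d : Fin 4, Even (Finset.univ.filter fun x : Fin 4 =>
      (x.val + d.val) % 2 = 0).card := by decide
    simpa using A d
  · subst h1
    simp only [if_true]
    revert d; decide
  · simp only [if_neg h1.ne', if_neg (not_lt.2 h1.le)]
    have A : ∀ d : Fin 4, Even (Finset.univ.filter fun x : Fin 4 =>
      (x.val + d.val) % 2 = 1).card := by decide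
    simpa using A d

theorem beat_out {q : ℕ} (x : Fin q × Fin 4) (m' : Fin q) : ∃ d, beat x (m', d) = true := by
  obtain ⟨m, c⟩ := x
  unfold beat
  simp only
  rcases lt_trichotomy m m' with h1 | h1 | h1
  · simp only [if_neg h1.ne, if_pos h1]
    have A : ∀ c : Fin 4, ∃ d : Fin 4, (c.val + d.val) % 2 = 0 := by decide
    simpa using A c
  · subst h1
    simp only [if_true]
    revert c; decide
  · simp only [if_neg h1.ne', if_neg (not_lt.2 h1.le)]
    have A : ∀ c : Fin 4, ∃ d : Fin 4, (c.val + d.val) % 2 = 1 := by decide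
    simpa using A c

theorem beat_card (q : ℕ) :
    (Finset.univ.filter fun p : (Fin q × Fin 4) × (Fin q × Fin 4) => beat p.1 p.2 = true).card
      = (8 * q - 2) * q := by
  set I := Fin q × Fin 4
  have h1 : (Finset.univ.filter fun p : I × I => beat p.1 p.2 = true).card
      = (Finset.univ.filter fun p : I × I => beat p.2 p.1 = true).card := by
    apply Finset.card_bij (fun p _ => (p.2, p.1))
    · intro a ha; simpa using ha
    · rintro ⟨a, b⟩ _ ⟨c, d⟩ _ h
      simp only [Prod.mk.injEq] at h ⊢
      exact ⟨h.2, h.1⟩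
    · rintro ⟨a, b⟩ h
      exact ⟨(b, a), by simpa using h, rfl⟩
  have h2 : (Finset.univ : Finset I).offDiag =
      (Finset.univ.filter fun p : I × I => beat p.1 p.2 = true) ∪
      (Finset.univ.filter fun p : I × I => beat p.2 p.1 = true) := by
    ext ⟨a, b⟩
    simp only [Finset.mem_offDiag, Finset.mem_univ, true_and, Finset.mem_union,
      Finset.mem_filter]
    by_cases hab : a = b
    · subst hab; simp [beat_irrefl]
    · have := beat_anti a b hab
      rw [this]
      simp [hab]
  have h3 : Disjoint (Finset.univ.filter fun p : I × I => beat p.1 p.2 = true)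
      (Finset.univ.filter fun p : I × I => beat p.2 p.1 = true) := by
    rw [Finset.disjoint_filter]
    rintro ⟨a, b⟩ _ h h'
    simp only at h h'
    by_cases hab : a = b
    · subst hab; simp [beat_irrefl] at h
    · have := beat_anti a b hab
      rw [h, h'] at this
      simp at this
  have h4 := Finset.offDiag_card (Finset.univ : Finset I)
  rw [h2, Finset.card_union_of_disjoint h3, ← h1] at h4
  have h5 : (Finset.univ : Finset I).card = 4 * q := by
    simp [I, mul_comm]
  rw [h5] at h4
  have h6 : 4 * q * (4 * q) - 4 * q = 2 * ((8 * q - 2) * q) := by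
    rcases q with _ | r
    · rfl
    · have : 8 * (r + 1) - 2 = 8 * r + 6 := by omega
      rw [this, Nat.sub_eq_iff_eq_add (by nlinarith)]
      ring
  rw [h6] at h4
  exact Nat.eq_of_mul_eq_mul_left two_pos ((two_mul _).trans h4)

theorem exists_KS (q : ℕ) (hq : 1 ≤ q) :
    ∃ K S : (Fin q × Fin 4) → (Fin q × Fin 4) → ℕ,
      (∀ i j, beat i j = true → K i j < 8 * q - 2 ∧ S i j < q) ∧
      (∀ k s, k < 8 * q - 2 → s < q → ∃ i j, beat i j = true ∧ K i j = k ∧ S i j = s) ∧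
      (∀ i, ∃ k, k < 8 * q - 2 ∧ ∀ s, s < q → ∃ j, beat i j = true ∧ K i j = k ∧ S i j = s) := by
  classical
  choose d hd using fun (x : Fin q × Fin 4) (m : Fin q) => beat_out x m
  have e : Fin (4 * q) ≃ Fin q × Fin 4 := Fintype.equivOfCardEq (by simp [mul_comm])
  let i0 : Fin q × Fin 4 := (⟨0, hq⟩, 0)
  let f : Fin (8 * q - 2) × Fin q → (Fin q × Fin 4) × (Fin q × Fin 4) := fun p =>
    if h : p.1.val < 4 * q then (e ⟨p.1.val, h⟩, (p.2, d (e ⟨p.1.val, h⟩) p.2)) else (i0, i0)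
  let t := Finset.univ.filter fun p : (Fin q × Fin 4) × (Fin q × Fin 4) => beat p.1 p.2 = true
  have hcard : Fintype.card (Fin (8 * q - 2) × Fin q) = t.card := by
    rw [beat_card]; simp
  obtain ⟨g, hg⟩ := Finset.exists_equiv_extend_of_card_eq (t := t) hcard
    (s := Finset.univ.filter fun p => p.1.val < 4 * q) (f := f)
    (by
      intro x hx
      simp only [Finset.mem_image, Finset.mem_filter, Finset.mem_univ, true_and] at hx
      obtain ⟨p, hp, rfl⟩ := hx
      simp only [f, dif_pos hp, t, Finset.mem_filter, Finset.mem_univ, true_and]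
      exact hd _ _)
    (by
      rintro ⟨k, s⟩ hp ⟨k', s'⟩ hp' h
      simp only [Finset.coe_filter, Finset.mem_univ, true_and, Set.mem_ofPred_eq] at hp hp'
      simp only [f, dif_pos hp, dif_pos hp', Prod.mk.injEq] at h
      have h1 := e.injective h.1
      simp only [Fin.mk.injEq] at h1
      rw [Fin.ext h1, h.2.1])
  let K : (Fin q × Fin 4) → (Fin q × Fin 4) → ℕ := fun i j =>
    if h : (i, j) ∈ t then (g.symm ⟨(i, j), h⟩).1.val else 0
  let S : (Fin q × Fin 4) → (Fin q × Fin 4) → ℕ := fun i j =>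
    if h : (i, j) ∈ t then (g.symm ⟨(i, j), h⟩).2.val else 0
  have key : ∀ p, beat (g p).1.1 (g p).1.2 = true ∧ K (g p).1.1 (g p).1.2 = p.1.val ∧
      S (g p).1.1 (g p).1.2 = p.2.val := by
    intro p
    have hm : ((g p).1.1, (g p).1.2) ∈ t := (g p).2
    have hgp : (⟨((g p).1.1, (g p).1.2), hm⟩ : {x // x ∈ t}) = g p := rfl
    refine ⟨(Finset.mem_filter.1 hm).2, ?_, ?_⟩
    · simp only [K, dif_pos hm, hgp, Equiv.symm_apply_apply]
    · simp only [S, dif_pos hm, hgp, Equiv.symm_apply_apply]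
  refine ⟨K, S, ?_, ?_, ?_⟩
  · intro i j h
    have hm : (i, j) ∈ t := by simpa [t] using h
    simp only [K, S, dif_pos hm]
    exact ⟨Fin.isLt _, Fin.isLt _⟩
  · intro k s hk hs
    exact ⟨_, _, key (⟨k, hk⟩, ⟨s, hs⟩)⟩
  · intro i
    have hlt : (e.symm i).val < 8 * q - 2 := by
      have := (e.symm i).isLt; omega
    refine ⟨(e.symm i).val, hlt, fun s hs => ?_⟩
    have h1 := key (⟨(e.symm i).val, hlt⟩, ⟨s, hs⟩)
    have h2 := hg (⟨(e.symm i).val, hlt⟩, ⟨s, hs⟩) (by simp)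
    have h3 : (g (⟨(e.symm i).val, hlt⟩, ⟨s, hs⟩)).1.1 = i := by
      rw [h2]; simp [f]
    rw [h3] at h1
    exact ⟨_, h1⟩

theorem exists_sign (q : ℕ) : ∃ sg : (Fin q × Fin 4) → (Fin q × Fin 4) → Bool, ∀ j,
    ∑ i ∈ Finset.univ.filter (fun i => beat i j = true), (if sg i j = true then (1 : ℤ) else -1) = 0 := by
  classical
  have h : ∀ j : Fin q × Fin 4, ∃ T ⊆ Finset.univ.filter (fun i => beat i j = true),
      T.card = (Finset.univ.filter (fun i => beat i j = true)).card / 2 := fun j =>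
    Finset.exists_subset_card_eq (Nat.div_le_self _ _)
  choose T hT hc using h
  refine ⟨fun i j => decide (i ∈ T j), fun j => ?_⟩
  simp only [decide_eq_true_eq]
  rw [← Finset.sum_sdiff (hT j), Finset.sum_congr rfl (g := fun _ => (-1 : ℤ)),
    Finset.sum_congr (s₁ := T j) rfl (g := fun _ => (1 : ℤ))]
  · have h1 := Finset.card_sdiff_add_card_eq_card (hT j)
    obtain ⟨r, hr⟩ := beat_even j
    have h2 := hc j
    simp only [Finset.sum_const]
    have : (Finset.univ.filter (fun i => beat i j = true) \ T j).card = (T j).card := by omega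
    rw [this]; simp
  · intro x hx; rw [if_pos hx]
  · intro x hx; rw [if_neg (Finset.mem_sdiff.1 hx).2]

theorem sum_erase_prod {I : Type*} [Fintype I] [DecidableEq I] (G : I × Bool → ℤ) (i : I) (b : Bool) :
    ∑ y ∈ Finset.univ.erase (i, b), G y =
      G (i, !b) + ∑ j ∈ Finset.univ.erase i, (G (j, false) + G (j, true)) := by
  have h1 := Finset.add_sum_erase Finset.univ G (Finset.mem_univ (i, b))
  have h2 := Finset.add_sum_erase Finset.univ (fun j => G (j, false) + G (j, true))
    (Finset.mem_univ i)
  have h3 : ∑ y, G y = ∑ j, (G (j, false) + G (j, true)) := by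
    rw [Fintype.sum_prod_type]
    apply Finset.sum_congr rfl
    intro j _
    simp [add_comm]
  cases b <;> simp <;> linarith

open scoped Classical in
theorem sum_inc (n : ℕ) (v : Fin n) (F : Sym2 (Fin n) → ℤ) :
    ∑ e ∈ Swap.incEdges n v, F e = ∑ w ∈ Finset.univ.erase v, F s(v, w) := by
  symm
  apply Finset.sum_bij (fun w _ => s(v, w))
  · intro w hw
    simp only [Swap.incEdges, Finset.mem_filter, Finset.mem_univ, true_and]
    have : w ≠ v := by simpa using hw
    simp [this.symm]
  · intro a _ b _ h
    exact Sym2.congr_right.1 h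
  · intro e he
    simp only [Swap.incEdges, Finset.mem_filter, Finset.mem_univ, true_and] at he
    obtain ⟨⟨w, rfl⟩, h2⟩ := he
    refine ⟨w, ?_, rfl⟩
    simp at h2 ⊢
    exact fun h => h2 h.symm
  · intro _ _; rfl

theorem sum_inc' {I : Type*} [Fintype I] [DecidableEq I] (n : ℕ) (ev : Fin n ≃ I × Bool)
    (i : I) (b : Bool) (F : Sym2 (Fin n) → ℤ) :
    ∑ e ∈ Swap.incEdges n (ev.symm (i, b)), F e =
      F s(ev.symm (i, b), ev.symm (i, !b)) + ∑ j ∈ Finset.univ.erase i,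
      (F s(ev.symm (i, b), ev.symm (j, false)) + F s(ev.symm (i, b), ev.symm (j, true))) := by
  rw [sum_inc, ← sum_erase_prod (fun y => F s(ev.symm (i, b), ev.symm y))]
  apply Finset.sum_equiv ev
  · intro x
    simp [Equiv.eq_symm_apply]
  · intro x _
    simp

end SwapAux

namespace SwapAux

section Construction

/-- label of an edge: low if the flag is set, high otherwise; `a` is the magnitude -/
def lab (E a : ℕ) (c : Bool) : ℕ := if c = true then a else E + 1 - a

def mag (q k s : ℕ) (b : Bool) : ℕ := 2 * q * k + (if b = true then q else 0) + s + 1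

theorem mag_bounds (q k s : ℕ) (b : Bool) (hq : 1 ≤ q) (hk : k < 8 * q - 2) (hs : s < q) :
    1 ≤ mag q k s b ∧ mag q k s b ≤ 4 * q * (4 * q - 1) := by
  have h1 : 2 * q * (k + 1) ≤ 2 * q * (8 * q - 2) := Nat.mul_le_mul_left _ (by omega)
  have h2 : 2 * q * (8 * q - 2) = 4 * q * (4 * q - 1) := by
    have : 8 * q - 2 = 2 * (4 * q - 1) := by omega
    rw [this]; ring
  rw [mul_add, h2] at h1
  unfold mag
  cases b <;> simp <;> omega

theorem mag_surj (q a : ℕ) (hq : 1 ≤ q) (h1 : 1 ≤ a) (h2 : a ≤ 4 * q * (4 * q - 1)) :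
    ∃ k s b, k < 8 * q - 2 ∧ s < q ∧ mag q k s b = a := by
  have h3 : (2 * q) * (8 * q - 2) = 4 * q * (4 * q - 1) := by
    have : 8 * q - 2 = 2 * (4 * q - 1) := by omega
    rw [this]; ring
  have hk : (a - 1) / (2 * q) < 8 * q - 2 := by
    apply Nat.div_lt_of_lt_mul
    omega
  have hm := Nat.div_add_mod (a - 1) (2 * q)
  have hl := Nat.mod_lt (a - 1) (show 2 * q > 0 by omega)
  by_cases h : (a - 1) % (2 * q) < q
  · refine ⟨_, (a - 1) % (2 * q), false, hk, h, ?_⟩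
    simp only [mag]
    simp
    omega
  · refine ⟨_, (a - 1) % (2 * q) - q, true, hk, by omega, ?_⟩
    simp only [mag]
    simp
    omega

variable {q : ℕ}

def glab (N : ℕ) (K S : (Fin q × Fin 4) → (Fin q × Fin 4) → ℕ)
    (sg : (Fin q × Fin 4) → (Fin q × Fin 4) → Bool) (idx : (Fin q × Fin 4) ≃ Fin (4 * q))
    (x y : (Fin q × Fin 4) × Bool) : ℕ :=
  if x.1 = y.1 then N + 1 + (idx x.1).val
  else if beat x.1 y.1 = true then
    lab (2 * N + 4 * q) (mag q (K x.1 y.1) (S x.1 y.1) x.2) (xor (xor (sg x.1 y.1) x.2) y.2)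
  else
    lab (2 * N + 4 * q) (mag q (K y.1 x.1) (S y.1 x.1) y.2) (xor (xor (sg y.1 x.1) y.2) x.2)

theorem glab_symm (N : ℕ) (K S : (Fin q × Fin 4) → (Fin q × Fin 4) → ℕ)
    (sg : (Fin q × Fin 4) → (Fin q × Fin 4) → Bool) (idx : (Fin q × Fin 4) ≃ Fin (4 * q))
    (x y : (Fin q × Fin 4) × Bool) : glab N K S sg idx x y = glab N K S sg idx y x := by
  unfold glab
  by_cases h : x.1 = y.1
  · rw [if_pos h, if_pos h.symm, h]
  · rw [if_neg h, if_neg (Ne.symm h)]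
    have := beat_anti x.1 y.1 h
    cases h' : beat y.1 x.1 <;> simp [this, h']

theorem glab_diag (N : ℕ) (K S : (Fin q × Fin 4) → (Fin q × Fin 4) → ℕ)
    (sg : (Fin q × Fin 4) → (Fin q × Fin 4) → Bool) (idx : (Fin q × Fin 4) ≃ Fin (4 * q))
    (i : Fin q × Fin 4) (b b' : Bool) : glab N K S sg idx (i, b) (i, b') = N + 1 + (idx i).val := by
  simp [glab]

theorem beat_ne {i j : Fin q × Fin 4} (h : beat i j = true) : i ≠ j := by
  rintro rfl
  simp [beat_irrefl] at h

theorem glab_beat (N : ℕ) (K S : (Fin q × Fin 4) → (Fin q × Fin 4) → ℕ)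
    (sg : (Fin q × Fin 4) → (Fin q × Fin 4) → Bool) (idx : (Fin q × Fin 4) ≃ Fin (4 * q))
    (i j : Fin q × Fin 4) (h : beat i j = true) (b b' : Bool) :
    glab N K S sg idx (i, b) (j, b') =
      lab (2 * N + 4 * q) (mag q (K i j) (S i j) b) (xor (xor (sg i j) b) b') := by
  simp [glab, beat_ne h, h]

end Construction

theorem eps_eq (q : ℕ) (hq : 1 ≤ q) :
    Swap.eps (8 * q) = 2 * (4 * q * (4 * q - 1)) + 4 * q := by
  unfold Swap.eps
  obtain ⟨r, rfl⟩ : ∃ r, q = r + 1 := ⟨q - 1, by omega⟩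
  have h1 : 8 * (r + 1) - 1 = 8 * r + 7 := by omega
  have h2 : 4 * (r + 1) - 1 = 4 * r + 3 := by omega
  rw [h1, h2]
  apply Nat.div_eq_of_eq_mul_left two_pos
  ring

end SwapAux

open scoped Classical in
theorem stmt14_aux (q : ℕ) (hq : 2 ≤ q) :
    ∃ T : Sym2 (Fin (8 * q)) → ℕ, Swap.AstrayGood (8 * q) 1 T ∧
      ∀ p : ℕ, 0 < p → 2 * p ≤ q → Swap.LabelingHasType (8 * q) p 2 (2 * q) T := by
  have hq1 : 1 ≤ q := by omega
  obtain ⟨K, S, hKS, hsurj, hint⟩ := SwapAux.exists_KS q hq1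
  obtain ⟨sg, hsg⟩ := SwapAux.exists_sign q
  have idx : (Fin q × Fin 4) ≃ Fin (4 * q) := Fintype.equivOfCardEq (by simp [mul_comm])
  have ev : Fin (8 * q) ≃ (Fin q × Fin 4) × Bool := Fintype.equivOfCardEq (by simp; ring)
  obtain ⟨N, hN⟩ : ∃ N, N = 4 * q * (4 * q - 1) := ⟨_, rfl⟩
  have hE : Swap.eps (8 * q) = 2 * N + 4 * q := by rw [hN]; exact SwapAux.eps_eq q hq1
  have hmb : ∀ i j b, SwapAux.beat i j = true → 1 ≤ SwapAux.mag q (K i j) (S i j) b ∧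
      SwapAux.mag q (K i j) (S i j) b ≤ N := by
    intro i j b h
    rw [hN]
    exact SwapAux.mag_bounds _ _ _ _ hq1 (hKS i j h).1 (hKS i j h).2
  obtain ⟨T, hT⟩ : ∃ T : Sym2 (Fin (8 * q)) → ℕ, ∀ x y,
      T s(ev.symm x, ev.symm y) = SwapAux.glab N K S sg idx x y :=
    ⟨Sym2.lift ⟨fun x y => SwapAux.glab N K S sg idx (ev x) (ev y), fun _ _ =>
      SwapAux.glab_symm _ _ _ _ _ _ _⟩, fun x y => by simp⟩
  have hTd : ∀ i b b', T s(ev.symm (i, b), ev.symm (i, b')) = N + 1 + (idx i).val := by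
    intro i b b'; rw [hT, SwapAux.glab_diag]
  have hTb : ∀ i j, SwapAux.beat i j = true → ∀ b b', T s(ev.symm (i, b), ev.symm (j, b')) =
      SwapAux.lab (2 * N + 4 * q) (SwapAux.mag q (K i j) (S i j) b) (xor (xor (sg i j) b) b') := by
    intro i j h b b'; rw [hT, SwapAux.glab_beat _ _ _ _ _ _ _ h]
  -- contribution of `j` to the vertex `(i,b)`
  have hout : ∀ i j, SwapAux.beat i j = true → ∀ b, ∀ f : ℕ → ℤ,
      f (T s(ev.symm (i, b), ev.symm (j, false))) + f (T s(ev.symm (i, b), ev.symm (j, true)))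
      = f (SwapAux.mag q (K i j) (S i j) b)
        + f (2 * N + 4 * q + 1 - SwapAux.mag q (K i j) (S i j) b) := by
    intro i j h b f
    rw [hTb i j h, hTb i j h]
    unfold SwapAux.lab
    cases sg i j <;> cases b <;> simp [add_comm]
  have hin : ∀ i j, SwapAux.beat j i = true → ∀ b, ∀ f : ℕ → ℤ,
      f (T s(ev.symm (i, b), ev.symm (j, false))) + f (T s(ev.symm (i, b), ev.symm (j, true)))
      = if xor (sg j i) b = true then
          f (SwapAux.mag q (K j i) (S j i) false)
            + f (2 * N + 4 * q + 1 - SwapAux.mag q (K j i) (S j i) true)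
        else f (2 * N + 4 * q + 1 - SwapAux.mag q (K j i) (S j i) false)
            + f (SwapAux.mag q (K j i) (S j i) true) := by
    intro i j h b f
    rw [Sym2.eq_swap, Sym2.eq_swap (a := ev.symm (i, b)) (b := ev.symm (j, true)),
      hTb j i h, hTb j i h]
    unfold SwapAux.lab
    cases sg j i <;> cases b <;> simp
  have hsum : ∀ i b, ∀ f : ℕ → ℤ, ∑ e ∈ Swap.incEdges (8 * q) (ev.symm (i, b)), f (T e) =
      f (N + 1 + (idx i).val) + ∑ j ∈ Finset.univ.erase i,
        (f (T s(ev.symm (i, b), ev.symm (j, false)))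
          + f (T s(ev.symm (i, b), ev.symm (j, true)))) := by
    intro i b f
    rw [← hTd i b (!b)]
    convert SwapAux.sum_inc' (8 * q) ev i b (fun e => f (T e))
  have hcases : ∀ i j : Fin q × Fin 4, i ≠ j → SwapAux.beat i j = true ∨ SwapAux.beat j i = true := by
    intro i j h
    rw [SwapAux.beat_anti i j h]
    cases SwapAux.beat j i <;> simp
  -- `T` is a labeling
  have hmaps : ∀ e : Sym2 (Fin (8 * q)), ¬ e.IsDiag → 1 ≤ T e ∧ T e ≤ 2 * N + 4 * q := by
    have hb : ∀ i j, SwapAux.beat i j = true → ∀ b b',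
        1 ≤ T s(ev.symm (i, b), ev.symm (j, b')) ∧
          T s(ev.symm (i, b), ev.symm (j, b')) ≤ 2 * N + 4 * q := by
      intro i j h b b'
      rw [hTb i j h]
      have := hmb i j b h
      unfold SwapAux.lab
      split_ifs <;> omega
    intro e
    induction e with
    | h x y =>
      intro _
      obtain ⟨⟨i, b⟩, rfl⟩ := ev.symm.surjective x
      obtain ⟨⟨j, b'⟩, rfl⟩ := ev.symm.surjective y
      by_cases hij : i = j
      · subst hij
        rw [hTd]
        have := (idx i).isLt
        omega
      · rcases hcases i j hij with h | h
        · exact hb i j h b b'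
        · rw [Sym2.eq_swap]; exact hb j i h b' b
  have honto : ∀ y, 1 ≤ y → y ≤ 2 * N + 4 * q → ∃ e : Sym2 (Fin (8 * q)), ¬ e.IsDiag ∧ T e = y := by
    have hlow : ∀ a, 1 ≤ a → a ≤ N → ∀ c, ∃ e : Sym2 (Fin (8 * q)), ¬ e.IsDiag ∧
        T e = SwapAux.lab (2 * N + 4 * q) a c := by
      intro a h1 h2 c
      obtain ⟨k, s, b, hk, hs, rfl⟩ := SwapAux.mag_surj q a hq1 h1 (hN ▸ h2)
      obtain ⟨i, j, hb, rfl, rfl⟩ := hsurj k s hk hs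
      refine ⟨s(ev.symm (i, b), ev.symm (j, xor c (xor (sg i j) b))), ?_, ?_⟩
      · simp [SwapAux.beat_ne hb]
      · rw [hTb i j hb]
        congr 1
        cases c <;> cases sg i j <;> cases b <;> rfl
    intro y h1 h2
    by_cases h3 : y ≤ N
    · obtain ⟨e, he, h⟩ := hlow y h1 h3 true
      exact ⟨e, he, by simpa [SwapAux.lab] using h⟩
    · by_cases h4 : y ≤ N + 4 * q
      · refine ⟨s(ev.symm (idx.symm ⟨y - (N + 1), by omega⟩, false),
          ev.symm (idx.symm ⟨y - (N + 1), by omega⟩, true)), by simp, ?_⟩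
        rw [hTd]
        simp
        omega
      · obtain ⟨e, he, h⟩ := hlow (2 * N + 4 * q + 1 - y) (by omega) (by omega) false
        refine ⟨e, he, ?_⟩
        rw [h]
        simp [SwapAux.lab]
        omega
  have hcardE : (Finset.univ.filter fun e : Sym2 (Fin (8 * q)) => ¬ e.IsDiag).card
      = 2 * N + 4 * q := by
    rw [← hE, ← Fintype.card_subtype, Sym2.card_subtype_not_diag, Fintype.card_fin,
      Nat.choose_two_right]
    rfl
  have hinj : Set.InjOn T {e : Sym2 (Fin (8 * q)) | ¬ e.IsDiag} := by
    have := Finset.injOn_of_surjOn_of_card_le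
      (s := Finset.univ.filter fun e : Sym2 (Fin (8 * q)) => ¬ e.IsDiag)
      (t := Finset.Icc 1 (2 * N + 4 * q)) T
      (by
        intro e he
        simp only [Finset.coe_filter, Finset.mem_univ, true_and, Set.mem_ofPred_eq] at he
        simpa using hmaps e he)
      (by
        intro y hy
        simp only [Finset.coe_Icc, Set.mem_Icc] at hy
        obtain ⟨e, he, h⟩ := honto y hy.1 hy.2
        exact ⟨e, by simpa using he, h⟩)
      (by rw [hcardE]; simp)
    intro a ha b hb hab
    exact this (by simpa using ha) (by simpa using hb) hab
  have hlabel : Swap.IsEdgeLabeling (8 * q) T := by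
    refine ⟨?_, hinj, ?_⟩
    · intro e he
      rw [hE]
      exact hmaps e he
    · intro y hy
      rw [hE] at hy
      obtain ⟨e, he, h⟩ := honto y hy.1 hy.2
      exact ⟨e, he, h⟩
  refine ⟨T, ⟨hlabel, ?_⟩, ?_⟩
  · let A : Finset (Sym2 (Fin (8 * q))) := Finset.univ.filter fun e =>
      ¬ e.IsDiag ∧ N < T e ∧ T e ≤ N + 4 * q
    have hAim : A.image T = Finset.Icc (N + 1) (N + 4 * q) := by
      ext y
      simp only [A, Finset.mem_image, Finset.mem_filter, Finset.mem_univ, true_and, Finset.mem_Icc]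
      constructor
      · rintro ⟨e, ⟨_, h1, h2⟩, rfl⟩
        exact ⟨h1, h2⟩
      · rintro ⟨h1, h2⟩
        obtain ⟨e, he, rfl⟩ := honto y (by omega) (by omega)
        exact ⟨e, ⟨he, h1, h2⟩, rfl⟩
    have hAc : A.card = 4 * q := by
      have h1 : (A.image T).card = A.card := by
        apply Finset.card_image_of_injOn
        intro a ha b hb hab
        simp only [A, Finset.coe_filter, Finset.mem_univ, true_and, Set.mem_ofPred_eq] at ha hb
        exact hinj ha.1 hb.1 hab
      rw [← h1, hAim, Nat.card_Icc]
      omega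
    have hlo : (Swap.eps (8 * q) - A.card) / 2 = N := by rw [hE, hAc]; omega
    have hhi : (Swap.eps (8 * q) + A.card) / 2 = N + 4 * q := by rw [hE, hAc]; omega
    refine ⟨A, ?_, ?_, ?_, ?_⟩
    · intro e he
      exact (Finset.mem_filter.1 he).2.1
    · rw [hAc, hE]; omega
    · rw [hlo, hhi, hAim]
    · intro v
      obtain ⟨⟨i, b⟩, rfl⟩ := ev.symm.surjective v
      have hidx := (idx i).isLt
      have hinc : ∀ e ∈ Swap.incEdges (8 * q) (ev.symm (i, b)), ¬ e.IsDiag := by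
        intro e he
        exact (Finset.mem_filter.1 he).2.2
      rw [hlo, hhi]
      refine ⟨?_, ?_, ?_⟩
      · have h1 : Swap.incEdges (8 * q) (ev.symm (i, b)) ∩ A =
            (Swap.incEdges (8 * q) (ev.symm (i, b))).filter
              fun e => N < T e ∧ T e ≤ N + 4 * q := by
          ext e
          simp only [A, Finset.mem_inter, Finset.mem_filter, Finset.mem_univ, true_and]
          constructor
          · rintro ⟨h1, h2, h3⟩; exact ⟨h1, h3⟩
          · rintro ⟨h1, h3⟩; exact ⟨h1, hinc e h1, h3⟩
        have h2 := hsum i b (fun y => if N < y ∧ y ≤ N + 4 * q then 1 else 0)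
        rw [Finset.sum_eq_zero (s := Finset.univ.erase i), Finset.sum_boole, ← h1,
          if_pos (by omega)] at h2
        · have h3 : (((Swap.incEdges (8 * q) (ev.symm (i, b)) ∩ A).card : ℕ) : ℤ) = 1 := by
            rw [h2]; rfl
          omega
        · intro j hj
          have hij : i ≠ j := fun h => (Finset.mem_erase.1 hj).1 h.symm
          rcases hcases i j hij with h | h
          · rw [hout i j h b (fun y => if N < y ∧ y ≤ N + 4 * q then 1 else 0)]
            have := hmb i j b h
            rw [if_neg (by omega), if_neg (by omega)]; rfl
          · rw [hin i j h b (fun y => if N < y ∧ y ≤ N + 4 * q then 1 else 0)]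
            have h5 := hmb j i false h
            have h6 := hmb j i true h
            rw [if_neg (c := N < SwapAux.mag q (K j i) (S j i) false ∧ _) (by omega),
              if_neg (c := N < SwapAux.mag q (K j i) (S j i) true ∧ _) (by omega),
              if_neg (c := N < 2 * N + 4 * q + 1 - SwapAux.mag q (K j i) (S j i) false ∧ _)
                (by omega),
              if_neg (c := N < 2 * N + 4 * q + 1 - SwapAux.mag q (K j i) (S j i) true ∧ _)
                (by omega)]
            simp
      · have h2 := hsum i b (fun y => (if y ≤ N then 1 else 0) - (if N + 4 * q < y then 1 else 0))
        rw [Finset.sum_eq_zero (s := Finset.univ.erase i), Finset.sum_sub_distrib,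
          Finset.sum_boole, Finset.sum_boole, if_neg (by omega), if_neg (by omega)] at h2
        · have h3 : ∀ x y : ℕ, (x : ℤ) - (y : ℤ) = 0 - 0 + 0 → x = y := by
            intro x y h; omega
          exact h3 _ _ h2
        · intro j hj
          have hij : i ≠ j := fun h => (Finset.mem_erase.1 hj).1 h.symm
          rcases hcases i j hij with h | h
          · rw [hout i j h b (fun y => (if y ≤ N then 1 else 0) - (if N + 4 * q < y then 1 else 0))]
            have := hmb i j b h
            split_ifs <;> omega
          · rw [hin i j h b (fun y => (if y ≤ N then 1 else 0) - (if N + 4 * q < y then 1 else 0))]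
            have h5 := hmb j i false h
            have h6 := hmb j i true h
            split_ifs <;> omega
      · have hmag : ∀ k s, SwapAux.mag q k s true = SwapAux.mag q k s false + q := by
          intro k s; simp [SwapAux.mag]; ring
        have h1 : Swap.incEdges (8 * q) (ev.symm (i, b)) \ A =
            (Swap.incEdges (8 * q) (ev.symm (i, b))).filter
              fun e => ¬ (N < T e ∧ T e ≤ N + 4 * q) := by
          ext e
          simp only [A, Finset.mem_sdiff, Finset.mem_filter, Finset.mem_univ, true_and]
          constructor
          · rintro ⟨h1, h2⟩; exact ⟨h1, fun h3 => h2 ⟨hinc e h1, h3⟩⟩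
          · rintro ⟨h1, h3⟩; exact ⟨h1, fun h4 => h3 h4.2⟩
        have h2 := hsum i b (fun y => if ¬ (N < y ∧ y ≤ N + 4 * q) then
          2 * (y : ℤ) - (2 * N + 4 * q + 1) else 0)
        have h3 : ∀ j ∈ Finset.univ.erase i,
            ((if ¬ (N < T s(ev.symm (i, b), ev.symm (j, false)) ∧
                T s(ev.symm (i, b), ev.symm (j, false)) ≤ N + 4 * q) then
              2 * ((T s(ev.symm (i, b), ev.symm (j, false)) : ℕ) : ℤ) - (2 * N + 4 * q + 1) else 0) +
            (if ¬ (N < T s(ev.symm (i, b), ev.symm (j, true)) ∧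
                T s(ev.symm (i, b), ev.symm (j, true)) ≤ N + 4 * q) then
              2 * ((T s(ev.symm (i, b), ev.symm (j, true)) : ℕ) : ℤ) - (2 * N + 4 * q + 1) else 0))
            = (if SwapAux.beat j i = true then (if sg j i = true then (1 : ℤ) else -1) else 0)
              * (if b = true then 2 * (q : ℤ) else - 2 * (q : ℤ)) := by
          intro j hj
          have hij : i ≠ j := fun h => (Finset.mem_erase.1 hj).1 h.symm
          rcases hcases i j hij with h | h
          · have h7 : SwapAux.beat j i = false := by
              have := SwapAux.beat_anti i j hij
              rw [h] at this
              cases h8 : SwapAux.beat j i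
              · rfl
              · rw [h8] at this; simp at this
            refine (hout i j h b (fun y => if ¬ (N < y ∧ y ≤ N + 4 * q) then
              2 * (y : ℤ) - (2 * N + 4 * q + 1) else 0)).trans ?_
            have := hmb i j b h
            rw [if_pos (by omega), if_pos (by omega), h7]
            simp only [Bool.false_eq_true, if_false, zero_mul]
            omega
          · refine (hin i j h b (fun y => if ¬ (N < y ∧ y ≤ N + 4 * q) then
              2 * (y : ℤ) - (2 * N + 4 * q + 1) else 0)).trans ?_
            have h5 := hmb j i false h
            have h6 := hmb j i true h
            have h7 := hmag (K j i) (S j i)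
            generalize SwapAux.mag q (K j i) (S j i) false = a0 at *
            generalize SwapAux.mag q (K j i) (S j i) true = a1 at *
            rw [if_pos (c := ¬ (N < a0 ∧ _)) (by omega),
              if_pos (c := ¬ (N < a1 ∧ _)) (by omega),
              if_pos (c := ¬ (N < 2 * N + 4 * q + 1 - a0 ∧ _)) (by omega),
              if_pos (c := ¬ (N < 2 * N + 4 * q + 1 - a1 ∧ _)) (by omega), if_pos h]
            cases sg j i <;> cases b <;> simp <;> omega
        rw [Finset.sum_congr rfl h3, ← Finset.sum_mul] at h2
        have h4 : ∑ j ∈ Finset.univ.erase i,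
            (if SwapAux.beat j i = true then (if sg j i = true then (1 : ℤ) else -1) else 0) = 0 := by
          rw [Finset.sum_erase _ (by simp [SwapAux.beat_irrefl]), ← Finset.sum_filter]
          exact hsg i
        rw [h4, if_neg (by omega), ← Finset.sum_filter, ← h1, Finset.sum_sub_distrib,
          ← Finset.mul_sum, Finset.sum_const] at h2
        rw [hE]
        zify
        simp only [nsmul_eq_mul] at h2
        linarith
  · intro p _ hp v
    obtain ⟨⟨i, b⟩, rfl⟩ := ev.symm.surjective v
    obtain ⟨k, hk, hks⟩ := hint i
    obtain ⟨c, hc⟩ : ∃ c, c = 2 * q * k + (if b = true then q else 0) := ⟨_, rfl⟩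
    have hcN : c + q ≤ N := by
      have := (SwapAux.mag_bounds q k (q - 1) b hq1 hk (by omega)).2
      rw [← hN] at this
      unfold SwapAux.mag at this
      rw [← hc] at this
      omega
    have hmem : ∀ s, s < q → ∀ d, SwapAux.lab (2 * N + 4 * q) (c + s + 1) d ∈
        Swap.labelSet (8 * q) T (ev.symm (i, b)) := by
      intro s hs d
      obtain ⟨j, hb, h1, h2⟩ := hks s hs
      refine Finset.mem_image.2 ⟨s(ev.symm (i, b), ev.symm (j, xor d (xor (sg i j) b))), ?_, ?_⟩
      · simp [Swap.incEdges, SwapAux.beat_ne hb]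
      · rw [hTb i j hb, h1, h2]
        unfold SwapAux.mag
        rw [← hc]
        congr 1
        cases d <;> cases sg i j <;> cases b <;> rfl
    have hdisj : Disjoint (Finset.Icc (c + 1) (c + q))
        (Finset.Icc (2 * N + 4 * q + 1 - (c + q)) (2 * N + 4 * q - c)) := by
      rw [Finset.disjoint_left]
      intro x h1 h2
      rw [Finset.mem_Icc] at h1 h2
      omega
    have hne : Finset.Icc (c + 1) (c + q) ≠
        Finset.Icc (2 * N + 4 * q + 1 - (c + q)) (2 * N + 4 * q - c) := by
      intro h
      have h1 : c + 1 ∈ Finset.Icc (c + 1) (c + q) := Finset.mem_Icc.2 ⟨le_rfl, by omega⟩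
      exact Finset.disjoint_left.1 hdisj h1 (h ▸ h1)
    refine ⟨{Finset.Icc (c + 1) (c + q),
      Finset.Icc (2 * N + 4 * q + 1 - (c + q)) (2 * N + 4 * q - c)}, Finset.card_le_two, ?_, ?_, ?_⟩
    · intro J hJ
      simp only [Finset.mem_insert, Finset.mem_singleton] at hJ
      rcases hJ with rfl | rfl
      · refine ⟨⟨_, _, by omega, rfl⟩, ?_, ?_⟩
        · intro x hx
          rw [Finset.mem_Icc] at hx
          have := hmem (x - (c + 1)) (by omega) true
          unfold SwapAux.lab at this
          rw [if_pos rfl] at this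
          convert this using 1
          omega
        · rw [Nat.card_Icc]; omega
      · refine ⟨⟨_, _, by omega, rfl⟩, ?_, ?_⟩
        · intro x hx
          rw [Finset.mem_Icc] at hx
          have := hmem (2 * N + 4 * q - c - x) (by omega) false
          unfold SwapAux.lab at this
          rw [if_neg (by simp)] at this
          convert this using 1
          omega
        · rw [Nat.card_Icc]; omega
    · rw [Finset.coe_pair]
      intro a ha b hb hab
      simp only [Set.mem_insert_iff, Set.mem_singleton_iff] at ha hb
      rcases ha with rfl | rfl <;> rcases hb with rfl | rfl
      · exact absurd rfl hab
      · exact hdisj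
      · exact hdisj.symm
      · exact absurd rfl hab
    · rw [Finset.sum_pair hne, Nat.card_Icc, Nat.card_Icc]
      omega

theorem stmt14 (q : ℕ) (hq : 2 ≤ q) :
    ∃ T : Sym2 (Fin (8 * q)) → ℕ, Swap.AstrayGood (8 * q) 1 T ∧
      ∀ p : ℕ, 0 < p → 2 * p ≤ q → Swap.LabelingHasType (8 * q) p 2 (2 * q) T := by
  exact stmt14_aux q hq
end

section
/- Let k, p, m, ℓ be positive integers and set n = 2k+1. If there exists a 3-astray good edge labeling of K_{2k}, then there exists a 7n-almost supermagic edge labeling of K_n. Moreover, if n ≥ 4p+1 and the given labeling of K_{2k} is of (m,ℓ)_p type, then there exists a 7n-almost supermagic edge labeling of K_n which is of (max{m,2}, ℓ)_p type. -/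
open Finset

namespace Swap
open scoped Classical

theorem mem_inc {n : ℕ} {v : Fin n} {e : Sym2 (Fin n)} :
    e ∈ incEdges n v ↔ v ∈ e ∧ ¬ e.IsDiag := by
  simp [incEdges]

theorem card_verts_le {n : ℕ} (R : Finset (Fin n)) (e : Sym2 (Fin n)) :
    (R.filter fun v => v ∈ e).card ≤ 2 := by
  induction e with
  | _ a b =>
    refine (Finset.card_le_card (t := {a, b}) ?_).trans Finset.card_le_two
    intro v hv
    simpa using (Finset.mem_filter.1 hv).2

theorem card_verts_eq {n : ℕ} (e : Sym2 (Fin n)) (he : ¬ e.IsDiag) :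
    ((univ : Finset (Fin n)).filter fun v => v ∈ e).card = 2 := by
  induction e with
  | _ a b =>
    have hab : a ≠ b := by simpa using he
    rw [← Finset.card_pair hab]
    congr 1
    ext v
    simp

theorem double_count {n : ℕ} (R : Finset (Fin n)) (A : Finset (Sym2 (Fin n)))
    (hA : ∀ e ∈ A, ¬ e.IsDiag) :
    ∑ v ∈ R, (incEdges n v ∩ A).card = ∑ e ∈ A, (R.filter fun v => v ∈ e).card := by
  have := Finset.sum_card_bipartiteAbove_eq_sum_card_bipartiteBelow
    (s := R) (t := A) (fun (v : Fin n) (e : Sym2 (Fin n)) => v ∈ e)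
  unfold Finset.bipartiteAbove Finset.bipartiteBelow at this
  rw [← this]
  refine Finset.sum_congr rfl fun v _ => ?_
  congr 1
  ext e
  simp only [Finset.mem_inter, mem_inc, Finset.mem_filter]
  constructor
  · rintro ⟨⟨h1, h2⟩, h3⟩; exact ⟨h3, h1⟩
  · rintro ⟨h1, h2⟩; exact ⟨⟨h2, hA e h1⟩, h1⟩

theorem handshake {n : ℕ} (A : Finset (Sym2 (Fin n))) (hA : ∀ e ∈ A, ¬ e.IsDiag) :
    ∑ v, (incEdges n v ∩ A).card = 2 * A.card := by
  rw [double_count univ A hA, Finset.sum_congr rfl fun e he => card_verts_eq e (hA e he)]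
  simp [mul_comm]

/-- The counting step: many vertices with three astray edges force many astray labels. -/
theorem count_lemma {n : ℕ} (R : Finset (Fin n)) (A : Finset (Sym2 (Fin n)))
    (hA : ∀ e ∈ A, ¬ e.IsDiag) (s : Sym2 (Fin n) → ℤ) (hs : Set.InjOn s A) (M hi : ℤ)
    (hhi : ∀ e ∈ A, s e ≤ hi)
    (h3 : ∀ v ∈ R, 3 ≤ (incEdges n v ∩ A).card)
    (hM : ∀ v ∈ R, ∀ e ∈ incEdges n v ∩ A, M ≤ s e) :
    3 * R.card ≤ 2 * (hi + 1 - M).toNat := by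
  have h1 : 3 * R.card ≤ ∑ v ∈ R, (incEdges n v ∩ A).card := by
    rw [mul_comm, ← smul_eq_mul]; exact Finset.card_nsmul_le_sum _ _ _ h3
  set T := A.filter fun e => M ≤ s e with hT
  have h2 : ∑ v ∈ R, (incEdges n v ∩ A).card = ∑ v ∈ R, (incEdges n v ∩ T).card := by
    refine Finset.sum_congr rfl fun v hv => ?_
    congr 1
    ext e
    simp only [Finset.mem_inter, hT, Finset.mem_filter]
    constructor
    · rintro ⟨h, h'⟩; exact ⟨h, h', hM v hv e (Finset.mem_inter.2 ⟨h, h'⟩)⟩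
    · rintro ⟨h, h', _⟩; exact ⟨h, h'⟩
  have h4 : ∑ v ∈ R, (incEdges n v ∩ T).card ≤ 2 * T.card := by
    rw [double_count R T fun e he => hA e (Finset.mem_filter.1 he).1, mul_comm, ← smul_eq_mul]
    exact Finset.sum_le_card_nsmul _ _ _ fun e _ => card_verts_le R e
  have h5 : T.card ≤ (hi + 1 - M).toNat := by
    rw [← Int.card_Icc]
    refine Finset.card_le_card_of_injOn s ?_ ?_
    · intro e he
      have := Finset.mem_filter.1 he
      simp only [Finset.coe_Icc, Set.mem_Icc]
      exact ⟨this.2, hhi e this.1⟩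
    · exact hs.mono fun e he => (Finset.mem_filter.1 he).1
  omega

theorem card_inc {n : ℕ} (v : Fin n) : (incEdges n v).card = n - 1 := by
  have : incEdges n v = (univ.erase v).image fun u => s(v, u) := by
    ext e
    induction e with
    | _ a b =>
      simp only [mem_inc, Finset.mem_image, Finset.mem_erase, Finset.mem_univ, and_true,
        Sym2.mem_iff, Sym2.mk_isDiag_iff, Sym2.eq_iff]
      constructor
      · rintro ⟨rfl | rfl, h⟩
        · exact ⟨b, fun h' => h h'.symm, by simp⟩
        · exact ⟨a, h, by simp⟩
      · rintro ⟨u, hu, ⟨rfl, rfl⟩ | ⟨rfl, rfl⟩⟩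
        · exact ⟨by simp, fun h => hu h.symm⟩
        · exact ⟨by simp, fun h => hu h⟩
  rw [this, Finset.card_image_of_injective, Finset.card_erase_of_mem (Finset.mem_univ v)]
  · simp
  · intro a b h
    simp only [Sym2.eq_iff] at h
    rcases h with h | h
    · exact h.2
    · rw [h.2, h.1]

theorem sort_perm {N : ℕ} (f : Fin N → ℤ) :
    ∃ σ : Equiv.Perm (Fin N), ∀ u v, f u < f v → σ u < σ v := by
  refine ⟨(Tuple.sort f).symm, fun u v h => ?_⟩
  by_contra hc
  have := Tuple.monotone_sort f (not_lt.1 hc)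
  simp only [Function.comp_apply, Equiv.apply_symm_apply] at this
  omega

theorem sort_first {N : ℕ} (f : Fin N → ℤ) (v0 : Fin N) :
    ∃ σ : Equiv.Perm (Fin N), (σ v0 : ℕ) = 0 ∧
      ∀ u v, u ≠ v0 → v ≠ v0 → f u < f v → σ u < σ v := by
  obtain ⟨σ, hσ⟩ := sort_perm (Function.update f v0 (-(∑ v, |f v|) - 1))
  have hb : ∀ v, -(∑ v, |f v|) - 1 < f v := fun v => by
    have := Finset.single_le_sum (f := fun v => |f v|) (fun i _ => abs_nonneg _) (Finset.mem_univ v)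
    have := neg_abs_le (f v)
    omega
  refine ⟨σ, ?_, fun u v hu hv h => hσ u v (by simpa [hu, hv] using h)⟩
  by_contra hc
  have hN : 0 < N := by have := v0.2; omega
  have hw : σ.symm ⟨0, hN⟩ ≠ v0 := by
    intro h
    rw [← h] at hc
    simp at hc
  have := hσ v0 (σ.symm ⟨0, hN⟩) (by simpa [hw] using hb _)
  simp [Fin.lt_def] at this

theorem sort_last {N : ℕ} (f : Fin N → ℤ) (v0 : Fin N) :
    ∃ σ : Equiv.Perm (Fin N), (σ v0 : ℕ) + 1 = N ∧
      ∀ u v, u ≠ v0 → v ≠ v0 → f u < f v → σ u < σ v := by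
  obtain ⟨σ, h0, h1⟩ := sort_first (fun v => - f v) v0
  refine ⟨σ.trans Fin.revPerm, ?_, fun u v hu hv h => ?_⟩
  · have := v0.2
    simp [Fin.val_rev, h0]; omega
  · simpa using h1 v u hv hu (by simpa using h)

/-! ### Extension to one more vertex -/

theorem map_cs_inj {N : ℕ} :
    Function.Injective (Sym2.map (Fin.castSucc : Fin N → Fin (N + 1))) :=
  Sym2.map.injective (Fin.castSucc_injective N)

theorem last_notMem_map {N : ℕ} (e : Sym2 (Fin N)) :
    Fin.last N ∉ Sym2.map (Fin.castSucc : Fin N → Fin (N + 1)) e := by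
  rw [Sym2.mem_map]
  rintro ⟨a, _, h⟩
  exact (Fin.castSucc_lt_last a).ne h

theorem star_inj {N : ℕ} :
    Function.Injective (fun v : Fin N => s(v.castSucc, Fin.last N)) := by
  intro a b h
  simpa using h

theorem edge_cases {N : ℕ} (e : Sym2 (Fin (N + 1))) (he : ¬ e.IsDiag) :
    (∃ e' : Sym2 (Fin N), ¬ e'.IsDiag ∧ e = Sym2.map Fin.castSucc e') ∨
      ∃ v : Fin N, e = s(v.castSucc, Fin.last N) := by
  induction e with
  | _ a b =>
    have hab : a ≠ b := by simpa using he
    induction a using Fin.lastCases with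
    | last =>
      induction b using Fin.lastCases with
      | last => exact absurd rfl hab
      | cast b => exact Or.inr ⟨b, Sym2.eq_swap⟩
    | cast a =>
      induction b using Fin.lastCases with
      | last => exact Or.inr ⟨a, rfl⟩
      | cast b => exact Or.inl ⟨s(a, b), by simpa using hab, by simp⟩

theorem map_not_diag {N : ℕ} {e : Sym2 (Fin N)} :
    (Sym2.map (Fin.castSucc : Fin N → Fin (N + 1)) e).IsDiag ↔ e.IsDiag := by
  induction e with
  | _ a b => simp

theorem inc_cast {N : ℕ} (v : Fin N) :
    incEdges (N + 1) v.castSucc =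
      insert s(v.castSucc, Fin.last N) ((incEdges N v).image (Sym2.map Fin.castSucc)) := by
  ext e
  simp only [mem_inc, Finset.mem_insert, Finset.mem_image]
  constructor
  · rintro ⟨h1, h2⟩
    rcases edge_cases e h2 with ⟨e', h, rfl⟩ | ⟨u, rfl⟩
    · right
      refine ⟨e', ⟨?_, h⟩, rfl⟩
      obtain ⟨a, ha, h⟩ := Sym2.mem_map.1 h1
      rwa [← Fin.castSucc_injective N h]
    · left
      rcases Sym2.mem_iff.1 h1 with h | h
      · rw [h]
      · exact absurd h (Fin.castSucc_lt_last v).ne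
  · rintro (rfl | ⟨e', ⟨h1, h2⟩, rfl⟩)
    · exact ⟨by simp, by simpa using (Fin.castSucc_lt_last v).ne⟩
    · exact ⟨Sym2.mem_map.2 ⟨v, h1, rfl⟩, by rwa [map_not_diag]⟩

theorem inc_last {N : ℕ} :
    incEdges (N + 1) (Fin.last N) = univ.image fun v : Fin N => s(v.castSucc, Fin.last N) := by
  ext e
  simp only [mem_inc, Finset.mem_image, Finset.mem_univ, true_and]
  constructor
  · rintro ⟨h1, h2⟩
    rcases edge_cases e h2 with ⟨e', h, rfl⟩ | ⟨u, rfl⟩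
    · exact absurd h1 (last_notMem_map e')
    · exact ⟨u, rfl⟩
  · rintro ⟨v, rfl⟩
    exact ⟨by simp, by simpa using (Fin.castSucc_lt_last v).ne⟩

theorem ext_exists {N : ℕ} (f : Sym2 (Fin N) → ℕ) (g : Fin N → ℕ) :
    ∃ t' : Sym2 (Fin (N + 1)) → ℕ, (∀ e, t' (Sym2.map Fin.castSucc e) = f e) ∧
      ∀ v : Fin N, t' s(v.castSucc, Fin.last N) = g v := by
  refine ⟨Function.extend (Sym2.map Fin.castSucc) f
    (Function.extend (fun v : Fin N => s(v.castSucc, Fin.last N)) g 0), fun e => ?_, fun v => ?_⟩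
  · exact map_cs_inj.extend_apply _ _ _
  · rw [Function.extend_apply', star_inj.extend_apply]
    rintro ⟨e, he⟩
    exact last_notMem_map e (he ▸ Sym2.mem_mk_right _ _)

def sh (x N y : ℕ) : ℕ := if y ≤ x then y else y + N

theorem sh_inj (x N : ℕ) : Function.Injective (sh x N) := by
  intro a b h
  unfold sh at h
  split_ifs at h <;> omega

theorem ext_labeling {N : ℕ} (t : Sym2 (Fin N) → ℕ) (ht : IsEdgeLabeling N t)
    (hE : eps (N + 1) = eps N + N) (x : ℕ) (hx : x ≤ eps N) (σ : Equiv.Perm (Fin N))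
    (t' : Sym2 (Fin (N + 1)) → ℕ) (h1 : ∀ e, t' (Sym2.map Fin.castSucc e) = sh x N (t e))
    (h2 : ∀ v : Fin N, t' s(v.castSucc, Fin.last N) = x + 1 + σ v) :
    IsEdgeLabeling (N + 1) t' := by
  obtain ⟨hm, hi, hs⟩ := ht
  have hm' : ∀ e : Sym2 (Fin N), ¬ e.IsDiag → 1 ≤ t e ∧ t e ≤ eps N := fun e he => hm he
  have hne : ∀ (e : Sym2 (Fin N)) (v : Fin N), sh x N (t e) ≠ x + 1 + σ v := by
    intro e v h
    have := (σ v).2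
    unfold sh at h
    split_ifs at h <;> omega
  refine ⟨?_, ?_, ?_⟩
  · intro e he
    rcases edge_cases e he with ⟨e', h, rfl⟩ | ⟨v, rfl⟩
    · have := hm' e' h
      rw [h1, Set.mem_Icc, hE]
      unfold sh
      split_ifs <;> omega
    · have := (σ v).2
      rw [h2, Set.mem_Icc, hE]
      omega
  · intro e he e' he' hee
    rcases edge_cases e he with ⟨d, h, rfl⟩ | ⟨v, rfl⟩ <;>
      rcases edge_cases e' he' with ⟨d', h', rfl⟩ | ⟨v', rfl⟩
    · rw [h1, h1] at hee
      rw [hi h h' (sh_inj _ _ hee)]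
    · rw [h1, h2] at hee
      exact absurd hee (hne _ _)
    · rw [h1, h2] at hee
      exact absurd hee.symm (hne _ _)
    · rw [h2, h2] at hee
      have : σ v = σ v' := Fin.ext (by omega)
      rw [σ.injective this]
  · intro y hy
    rw [Set.mem_Icc, hE] at hy
    have key : ∀ z, 1 ≤ z → z ≤ eps N → sh x N z = y →
        y ∈ Set.image t' {e : Sym2 (Fin (N + 1)) | ¬ e.IsDiag} := by
      intro z hz1 hz2 hz
      obtain ⟨e, he, rfl⟩ := hs (Set.mem_Icc.2 ⟨hz1, hz2⟩)
      exact ⟨Sym2.map Fin.castSucc e, by simpa [map_not_diag] using he, by rw [h1, hz]⟩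
    by_cases ha : y ≤ x
    · exact key y hy.1 (by omega) (by simp [sh, ha])
    by_cases hb : y ≤ x + N
    · refine ⟨s((σ.symm ⟨y - (x + 1), by omega⟩).castSucc, Fin.last N), ?_, ?_⟩
      · simpa using (Fin.castSucc_lt_last _).ne
      · rw [h2]; simp; omega
    · exact key (y - N) (by omega) (by omega) (by
        unfold sh
        split_ifs <;> omega)

theorem sum_cast {N : ℕ} (t : Sym2 (Fin N) → ℕ) (x : ℕ) (σ : Equiv.Perm (Fin N))
    (t' : Sym2 (Fin (N + 1)) → ℕ) (h1 : ∀ e, t' (Sym2.map Fin.castSucc e) = sh x N (t e))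
    (h2 : ∀ v : Fin N, t' s(v.castSucc, Fin.last N) = x + 1 + σ v) (v : Fin N) :
    labelSum (N + 1) t' v.castSucc =
      (x + 1 + (σ v : ℕ) : ℤ) + ∑ e ∈ incEdges N v, (sh x N (t e) : ℤ) := by
  unfold labelSum
  rw [inc_cast, Finset.sum_insert, Finset.sum_image map_cs_inj.injOn, h2]
  · simp only [h1]; push_cast; rfl
  · rw [Finset.mem_image]
    rintro ⟨e, _, he⟩
    exact last_notMem_map e (he ▸ Sym2.mem_mk_right _ _)

theorem sum_last {N : ℕ} (x : ℕ) (σ : Equiv.Perm (Fin N))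
    (t' : Sym2 (Fin (N + 1)) → ℕ)
    (h2 : ∀ v : Fin N, t' s(v.castSucc, Fin.last N) = x + 1 + σ v) :
    2 * labelSum (N + 1) t' (Fin.last N) = N * (2 * x + N + 1) := by
  unfold labelSum
  rw [inc_last, Finset.sum_image star_inj.injOn]
  simp only [h2]
  rw [Equiv.sum_comp σ (fun i : Fin N => ((x + 1 + (i : ℕ) : ℕ) : ℤ)),
    Fin.sum_univ_eq_sum_range (fun i => ((x + 1 + i : ℕ) : ℤ))]
  have : ∀ M : ℕ, 2 * ∑ i ∈ Finset.range M, ((x + 1 + i : ℕ) : ℤ) = M * (2 * x + M + 1) := by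
    intro M
    induction M with
    | zero => simp
    | succ M ih => rw [Finset.sum_range_succ, mul_add, ih]; push_cast; ring
  exact this N

/-! ### Types -/

theorem type_transfer (p m ℓ c N : ℕ) (S S' : Finset ℕ) (hc : ¬ (c ∈ S ∧ c + 1 ∈ S))
    (hS : ∀ y ∈ S, sh c N y ∈ S')
    (h : SetHasType p m ℓ S) : SetHasType p m ℓ S' := by
  obtain ⟨F, h1, h2, h3, h4⟩ := h
  have himg : Function.Injective (fun I : Finset ℕ => I.image (sh c N)) :=
    Finset.image_injective (sh_inj c N)
  refine ⟨F.image fun I => I.image (sh c N), ?_, ?_, ?_, ?_⟩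
  · exact Finset.card_image_le.trans h1
  · intro J hJ
    obtain ⟨I, hI, rfl⟩ := Finset.mem_image.1 hJ
    obtain ⟨⟨a, b, hab, rfl⟩, hsub, hcard⟩ := h2 I hI
    refine ⟨?_, ?_, ?_⟩
    · by_cases hb : b ≤ c
      · refine ⟨a, b, hab, ?_⟩
        ext y
        simp only [Finset.mem_image, Finset.mem_Icc, sh]
        constructor
        · rintro ⟨z, hz, rfl⟩
          split_ifs <;> omega
        · intro hy
          exact ⟨y, hy, by split_ifs <;> omega⟩
      · have ha : c < a := by
          by_contra ha
          exact hc ⟨hsub (Finset.mem_Icc.2 ⟨by omega, by omega⟩),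
            hsub (Finset.mem_Icc.2 ⟨by omega, by omega⟩)⟩
        refine ⟨a + N, b + N, by omega, ?_⟩
        ext y
        simp only [Finset.mem_image, Finset.mem_Icc, sh]
        constructor
        · rintro ⟨z, hz, rfl⟩
          split_ifs <;> omega
        · intro hy
          exact ⟨y - N, by omega, by split_ifs <;> omega⟩
    · intro y hy
      obtain ⟨z, hz, rfl⟩ := Finset.mem_image.1 hy
      exact hS z (hsub hz)
    · rwa [Finset.card_image_of_injective _ (sh_inj c N)]
  · intro J hJ J' hJ' hne
    rw [Finset.mem_coe, Finset.mem_image] at hJ hJ'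
    obtain ⟨I, hI, rfl⟩ := hJ
    obtain ⟨I', hI', rfl⟩ := hJ'
    have hne' : I ≠ I' := fun h => hne (by rw [h])
    have := h3 hI hI' hne'
    simp only [Function.onFun, id] at this ⊢
    exact (Finset.disjoint_image (sh_inj c N)).2 this
  · rw [Finset.sum_image himg.injOn]
    refine h4.trans (le_of_eq (Finset.sum_congr rfl fun I _ => ?_))
    rw [Finset.card_image_of_injective _ (sh_inj c N)]

theorem type_mono (p m m' ℓ : ℕ) (S : Finset ℕ) (hm : m ≤ m') (h : SetHasType p m ℓ S) :
    SetHasType p m' ℓ S := by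
  obtain ⟨F, h1, h2⟩ := h
  exact ⟨F, h1.trans hm, h2⟩

theorem type_le_card (p m ℓ : ℕ) (S : Finset ℕ) (h : SetHasType p m ℓ S) : ℓ ≤ S.card := by
  obtain ⟨F, h1, h2, h3, h4⟩ := h
  refine h4.trans ?_
  have := Finset.card_biUnion (s := F) (t := id) (fun I hI J hJ hne => h3 hI hJ hne)
  simp only [id] at this
  rw [← this]
  exact Finset.card_le_card (Finset.biUnion_subset.2 fun I hI => (h2 I hI).2.1)

theorem type_Icc (p m ℓ a b : ℕ) (hm : 1 ≤ m) (hab : a ≤ b) (h1 : 2 * p ≤ b + 1 - a)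
    (h2 : ℓ ≤ b + 1 - a) (S : Finset ℕ) (hS : Finset.Icc a b ⊆ S) : SetHasType p m ℓ S := by
  refine ⟨{Finset.Icc a b}, by simpa using hm, ?_, by simp, by simpa using h2⟩
  intro I hI
  rw [Finset.mem_singleton] at hI
  subst hI
  exact ⟨⟨a, b, hab, rfl⟩, hS, by simpa using h1⟩

theorem set_cast {N : ℕ} (t : Sym2 (Fin N) → ℕ) (x : ℕ) (σ : Equiv.Perm (Fin N))
    (t' : Sym2 (Fin (N + 1)) → ℕ) (h1 : ∀ e, t' (Sym2.map Fin.castSucc e) = sh x N (t e))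
    (h2 : ∀ v : Fin N, t' s(v.castSucc, Fin.last N) = x + 1 + σ v) (v : Fin N) :
    labelSet (N + 1) t' v.castSucc = insert (x + 1 + (σ v : ℕ)) ((labelSet N t v).image (sh x N)) := by
  unfold labelSet
  rw [inc_cast, Finset.image_insert, h2, Finset.image_image, Finset.image_image]
  congr 1
  refine Finset.image_congr fun e _ => ?_
  simp [h1]

theorem set_last {N : ℕ} (x : ℕ) (σ : Equiv.Perm (Fin N))
    (t' : Sym2 (Fin (N + 1)) → ℕ)
    (h2 : ∀ v : Fin N, t' s(v.castSucc, Fin.last N) = x + 1 + σ v) :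
    Finset.Icc (x + 1) (x + N) ⊆ labelSet (N + 1) t' (Fin.last N) := by
  intro y hy
  rw [Finset.mem_Icc] at hy
  unfold labelSet
  rw [inc_last, Finset.image_image, Finset.mem_image]
  refine ⟨σ.symm ⟨y - (x + 1), by omega⟩, Finset.mem_univ _, ?_⟩
  simp [h2]; omega

/-! ### Consequences of astray goodness -/

structure Data (k E : ℕ) (t : Sym2 (Fin (2 * k)) → ℕ) (A : Finset (Sym2 (Fin (2 * k)))) :
    Prop where
  nd : ∀ e ∈ A, ¬ e.IsDiag
  inj : ∀ e e' : Sym2 (Fin (2 * k)), ¬ e.IsDiag → ¬ e'.IsDiag → t e = t e' → e = e'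
  pos : ∀ e : Sym2 (Fin (2 * k)), ¬ e.IsDiag → 1 ≤ t e
  mem : ∀ e : Sym2 (Fin (2 * k)), ¬ e.IsDiag →
    (e ∈ A ↔ E < 2 * t e + A.card ∧ 2 * t e ≤ E + A.card)
  par : A.card % 2 = E % 2
  deg : ∀ v, (incEdges (2 * k) v ∩ A).card = 1 ∨ (incEdges (2 * k) v ∩ A).card = 3
  zero : ∀ v, ∑ e ∈ incEdges (2 * k) v \ A,
    (2 * (sh (E / 2) (2 * k) (t e) : ℤ) - (E + 2 * k + 1)) = 0

theorem data_of_astray {k : ℕ} (hk : 0 < k) (t : Sym2 (Fin (2 * k)) → ℕ)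
    (ht : AstrayGood (2 * k) 3 t) : ∃ A, Data k (eps (2 * k)) t A := by
  obtain ⟨⟨hm, hi, hs⟩, A, hA, hpar, himg, hv⟩ := ht
  generalize eps (2 * k) = E at *
  have hinj : ∀ e e' : Sym2 (Fin (2 * k)), ¬ e.IsDiag → ¬ e'.IsDiag → t e = t e' → e = e' :=
    fun e e' h h' hh => hi h h' hh
  have haE : A.card ≤ E := by
    have : A.card ≤ (Finset.Icc 1 E).card := by
      refine Finset.card_le_card_of_injOn t ?_ ?_
      · intro e he
        simpa using hm (hA e he)
      · intro e he e' he' h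
        exact hinj e e' (hA e he) (hA e' he') h
    simpa using this
  have hmem : ∀ e : Sym2 (Fin (2 * k)), ¬ e.IsDiag →
      (e ∈ A ↔ E < 2 * t e + A.card ∧ 2 * t e ≤ E + A.card) := by
    intro e he
    have h1 : e ∈ A ↔ t e ∈ A.image t := by
      constructor
      · exact fun h => Finset.mem_image_of_mem t h
      · intro h
        obtain ⟨e', he', h⟩ := Finset.mem_image.1 h
        rwa [← hinj e' e (hA e' he') he h]
    rw [h1, himg, Finset.mem_Icc]
    omega
  have hL : ∀ v, (incEdges (2 * k) v \ A).filter (fun e => t e ≤ (E - A.card) / 2) =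
      (incEdges (2 * k) v).filter fun e => t e ≤ (E - A.card) / 2 := by
    intro v
    ext e
    simp only [Finset.mem_filter, Finset.mem_sdiff]
    constructor
    · rintro ⟨⟨h1, h2⟩, h3⟩; exact ⟨h1, h3⟩
    · rintro ⟨h1, h3⟩
      refine ⟨⟨h1, ?_⟩, h3⟩
      rw [hmem e (mem_inc.1 h1).2]
      omega
  have hH : ∀ v, (incEdges (2 * k) v \ A).filter (fun e => ¬ t e ≤ (E - A.card) / 2) =
      (incEdges (2 * k) v).filter fun e => (E + A.card) / 2 < t e := by
    intro v
    ext e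
    simp only [Finset.mem_filter, Finset.mem_sdiff]
    constructor
    · rintro ⟨⟨h1, h2⟩, h3⟩
      rw [hmem e (mem_inc.1 h1).2] at h2
      exact ⟨h1, by omega⟩
    · rintro ⟨h1, h3⟩
      refine ⟨⟨h1, ?_⟩, by omega⟩
      rw [hmem e (mem_inc.1 h1).2]
      omega
  refine ⟨A, hA, hinj, fun e he => (hm he).1, hmem, hpar, ?_, ?_⟩
  · intro v
    obtain ⟨h3, hLH, -⟩ := hv v
    have h1 := Finset.card_inter_add_card_sdiff (incEdges (2 * k) v) A
    have h2 := Finset.card_filter_add_card_filter_not (s := incEdges (2 * k) v \ A)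
      (fun e => t e ≤ (E - A.card) / 2)
    rw [hL, hH] at h2
    rw [card_inc] at h1
    omega
  · intro v
    obtain ⟨h3, hLH, hsum⟩ := hv v
    have hstep : ∀ e ∈ incEdges (2 * k) v \ A,
        (2 * (sh (E / 2) (2 * k) (t e) : ℤ) - (E + 2 * k + 1)) =
        (2 * (t e : ℤ) - (E + 1)) + (if t e ≤ (E - A.card) / 2 then -(2 * k : ℤ) else 2 * k) := by
      intro e he
      obtain ⟨h1, h2⟩ := Finset.mem_sdiff.1 he
      rw [hmem e (mem_inc.1 h1).2] at h2
      unfold sh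
      split_ifs <;> push_cast <;> omega
    rw [Finset.sum_congr rfl hstep, Finset.sum_add_distrib, Finset.sum_ite, hL, hH,
      Finset.sum_sub_distrib, ← Finset.mul_sum]
    simp only [Finset.sum_const, hLH, nsmul_eq_mul]
    have : (2 * ∑ e ∈ incEdges (2 * k) v \ A, (t e : ℤ)) =
      ((incEdges (2 * k) v \ A).card : ℤ) * (E + 1) := by exact_mod_cast hsum
    rw [this]
    ring

/-- Doubled deviation of the astray edges at a vertex after shifting. -/
noncomputable def dev (k E : ℕ) (t : Sym2 (Fin (2 * k)) → ℕ) (A : Finset (Sym2 (Fin (2 * k))))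
    (v : Fin (2 * k)) : ℤ :=
  ∑ e ∈ incEdges (2 * k) v ∩ A, (2 * (sh (E / 2) (2 * k) (t e) : ℤ) - (E + 2 * k + 1))

theorem sum_formula {k E : ℕ} (hk : 0 < k) {t : Sym2 (Fin (2 * k)) → ℕ}
    {A : Finset (Sym2 (Fin (2 * k)))} (D : Data k E t A) (v : Fin (2 * k)) :
    2 * ∑ e ∈ incEdges (2 * k) v, (sh (E / 2) (2 * k) (t e) : ℤ) =
      (2 * k - 1) * (E + 2 * k + 1) + dev k E t A v := by
  have h1 := Finset.sum_inter_add_sum_sdiff (incEdges (2 * k) v) A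
    (fun e => (2 * (sh (E / 2) (2 * k) (t e) : ℤ) - (E + 2 * k + 1)))
  rw [D.zero v, add_zero] at h1
  unfold dev
  rw [h1, Finset.sum_sub_distrib, ← Finset.mul_sum]
  simp only [Finset.sum_const, nsmul_eq_mul, card_inc]
  have : ((2 * k - 1 : ℕ) : ℤ) = 2 * k - 1 := by omega
  rw [this]
  ring

theorem card_A_le {k E : ℕ} {t : Sym2 (Fin (2 * k)) → ℕ}
    {A : Finset (Sym2 (Fin (2 * k)))} (D : Data k E t A) : A.card ≤ 3 * k := by
  have h := handshake A D.nd
  have : ∑ v, (incEdges (2 * k) v ∩ A).card ≤ ∑ _v : Fin (2 * k), 3 :=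
    Finset.sum_le_sum fun v _ => by rcases D.deg v with h | h <;> omega
  simp at this
  omega

theorem term_bound {k E : ℕ} {t : Sym2 (Fin (2 * k)) → ℕ}
    {A : Finset (Sym2 (Fin (2 * k)))} (D : Data k E t A) (e) (he : e ∈ A) :
    |(2 * (sh (E / 2) (2 * k) (t e) : ℤ) - (E + 2 * k + 1))| ≤ 5 * k := by
  have h1 := card_A_le D
  have h2 := (D.mem e (D.nd e he)).1 he
  rw [abs_le]
  unfold sh
  split_ifs <;> push_cast <;> constructor <;> omega

theorem dev_split {k E : ℕ} {t : Sym2 (Fin (2 * k)) → ℕ}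
    {A : Finset (Sym2 (Fin (2 * k)))} (D : Data k E t A) (v : Fin (2 * k))
    (e) (he : e ∈ incEdges (2 * k) v ∩ A) :
    |dev k E t A v - (2 * (sh (E / 2) (2 * k) (t e) : ℤ) - (E + 2 * k + 1))| ≤ 10 * k := by
  unfold dev
  rw [← Finset.add_sum_erase _ _ he, add_sub_cancel_left]
  refine (Finset.abs_sum_le_sum_abs _ _).trans ?_
  refine (Finset.sum_le_card_nsmul _ _ (5 * k : ℤ) fun e' he' =>
    term_bound D e' (Finset.mem_inter.1 (Finset.mem_of_mem_erase he')).2).trans ?_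
  rw [Finset.card_erase_of_mem he]
  rcases D.deg v with h | h <;> rw [h] <;> simp <;> omega

theorem dev_small {k E : ℕ} {t : Sym2 (Fin (2 * k)) → ℕ}
    {A : Finset (Sym2 (Fin (2 * k)))} (D : Data k E t A) (v : Fin (2 * k))
    (hd : (incEdges (2 * k) v ∩ A).card = 1) : |dev k E t A v| ≤ 5 * k := by
  obtain ⟨e, he⟩ := Finset.card_eq_one.1 hd
  unfold dev
  rw [he, Finset.sum_singleton]
  refine term_bound D e ?_
  have : e ∈ incEdges (2 * k) v ∩ A := by rw [he]; simp
  exact (Finset.mem_inter.1 this).2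

theorem sum_bound {k E : ℕ} {t : Sym2 (Fin (2 * k)) → ℕ}
    {A : Finset (Sym2 (Fin (2 * k)))} (D : Data k E t A) (σ : Equiv.Perm (Fin (2 * k)))
    (Z : Finset (Fin (2 * k))) (hZ1 : Z.card ≤ 1)
    (hZ : ∀ v ∈ Z, |dev k E t A v| ≤ 10 * k)
    (hσ : ∀ u v, u ∉ Z → v ∉ Z → dev k E t A v < dev k E t A u → σ u < σ v) (u : Fin (2 * k)) :
    |dev k E t A u + (2 * ((E / 2 : ℕ) + 1 + (σ u : ℕ)) - (E + 2 * k + 1))| ≤ 14 * k + 7 := by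
  have hsu := (σ u).2
  by_cases huZ : u ∈ Z
  · have := abs_le.1 (hZ u huZ)
    rw [abs_le]
    constructor <;> omega
  have ha := card_A_le D
  rw [abs_le]
  constructor
  · by_contra hc
    set R := univ.filter fun v => v ∉ Z ∧ σ u ≤ σ v with hR
    have huR : u ∈ R := by simp [hR, huZ]
    have hRpos : 0 < R.card := Finset.card_pos.2 ⟨u, huR⟩
    have hRcard : 2 * k ≤ R.card + σ u + 1 := by
      have h1 : (univ.filter fun v => σ u ≤ σ v).card = 2 * k - σ u := by
        rw [← Fin.card_Ici, ← Finset.card_map (s := Finset.Ici (σ u)) σ.symm.toEmbedding]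
        congr 1
        ext v
        simp [Finset.mem_map_equiv]
      have h2 : (univ.filter fun v => σ u ≤ σ v) ⊆ R ∪ Z := by
        intro v hv
        by_cases hvZ : v ∈ Z
        · simp [hvZ]
        · simpa [hR, hvZ] using hv
      have := (Finset.card_le_card h2).trans (Finset.card_union_le _ _)
      omega
    have hdev : ∀ v ∈ R, dev k E t A v ≤ dev k E t A u := by
      intro v hv
      have hv' := (Finset.mem_filter.1 hv).2
      by_contra h
      exact absurd (hσ v u hv'.1 huZ (not_le.1 h)) (not_lt.2 hv'.2)
    have := count_lemma R A D.nd (fun e => -(t e : ℤ))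
      (fun e he e' he' h => D.inj e e' (D.nd e he) (D.nd e' he') (by simpa using h))
      (-((E + 1 - 4 * k + 2 * (2 * k - 1 - (σ u : ℕ)) - 4) / 2 : ℤ)) (-((E - 3 * k) / 2 : ℤ))
      ?_ ?_ ?_
    · omega
    · intro e he
      have := (D.mem e (D.nd e he)).1 he
      omega
    · intro v hv
      rcases D.deg v with h | h
      · have := abs_le.1 (dev_small D v h)
        have := hdev v hv
        omega
      · omega
    · intro v hv e he
      have h1 := abs_le.1 (dev_split D v e he)
      have h2 := hdev v hv
      have h3 : (t e : ℤ) ≤ sh (E / 2) (2 * k) (t e) := by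
        unfold sh; split_ifs <;> push_cast <;> omega
      omega
  · by_contra hc
    set R := univ.filter fun v => v ∉ Z ∧ σ v ≤ σ u with hR
    have huR : u ∈ R := by simp [hR, huZ]
    have hRpos : 0 < R.card := Finset.card_pos.2 ⟨u, huR⟩
    have hRcard : (σ u : ℕ) ≤ R.card := by
      have h1 : (univ.filter fun v => σ v ≤ σ u).card = σ u + 1 := by
        rw [← Fin.card_Iic, ← Finset.card_map (s := Finset.Iic (σ u)) σ.symm.toEmbedding]
        congr 1
        ext v
        simp [Finset.mem_map_equiv]
      have h2 : (univ.filter fun v => σ v ≤ σ u) ⊆ R ∪ Z := by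
        intro v hv
        by_cases hvZ : v ∈ Z
        · simp [hvZ]
        · simpa [hR, hvZ] using hv
      have := (Finset.card_le_card h2).trans (Finset.card_union_le _ _)
      omega
    have hdev : ∀ v ∈ R, dev k E t A u ≤ dev k E t A v := by
      intro v hv
      have hv' := (Finset.mem_filter.1 hv).2
      by_contra h
      exact absurd (hσ u v huZ hv'.1 (not_le.1 h)) (not_lt.2 hv'.2)
    have := count_lemma R A D.nd (fun e => (t e : ℤ))
      (fun e he e' he' h => D.inj e e' (D.nd e he) (D.nd e' he') (by simpa using h))
      ((E + 4 * k + 6 - 2 * (σ u : ℕ)) / 2 : ℤ) ((E + 3 * k) / 2 : ℤ)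
      ?_ ?_ ?_
    · omega
    · intro e he
      have := (D.mem e (D.nd e he)).1 he
      omega
    · intro v hv
      rcases D.deg v with h | h
      · have := abs_le.1 (dev_small D v h)
        have := hdev v hv
        omega
      · omega
    · intro v hv e he
      have h1 := abs_le.1 (dev_split D v e he)
      have h2 := hdev v hv
      have h3 : (sh (E / 2) (2 * k) (t e) : ℤ) ≤ t e + 2 * k := by
        unfold sh; split_ifs <;> push_cast <;> omega
      omega

theorem eps_facts (k : ℕ) (hk : 0 < k) :
    eps (2 * k + 1) = eps (2 * k) + 2 * k ∧ eps (2 * k) % 2 = k % 2 ∧ (k = 1 → eps (2 * k) = 1) := by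
  obtain ⟨j, rfl⟩ : ∃ j, k = j + 1 := ⟨k - 1, by omega⟩
  have h1 : eps (2 * (j + 1)) = 2 * (j * (j + 1)) + (j + 1) := by
    unfold eps
    have : 2 * (j + 1) - 1 = 2 * j + 1 := by omega
    rw [this]
    refine Nat.div_eq_of_eq_mul_left (by norm_num) ?_
    ring
  have h2 : eps (2 * (j + 1) + 1) = 2 * (j * (j + 1)) + (j + 1) + 2 * (j + 1) := by
    unfold eps
    have : 2 * (j + 1) + 1 - 1 = 2 * j + 2 := by omega
    rw [this]
    refine Nat.div_eq_of_eq_mul_left (by norm_num) ?_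
    ring
  refine ⟨by omega, by omega, ?_⟩
  intro hj
  obtain rfl : j = 0 := by omega
  omega

theorem mem_labelSet {n : ℕ} {t : Sym2 (Fin n) → ℕ} {v : Fin n} {y : ℕ} :
    y ∈ labelSet n t v ↔ ∃ e ∈ incEdges n v, t e = y := by
  simp [labelSet]

/-- The ordering of the new labels. -/
theorem choose_perm {k E : ℕ} (hk : 0 < k) (hE2 : E % 2 = k % 2) (hE1 : k = 1 → E = 1)
    {t : Sym2 (Fin (2 * k)) → ℕ}
    {A : Finset (Sym2 (Fin (2 * k)))} (D : Data k E t A) :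
    ∃ (σ : Equiv.Perm (Fin (2 * k))) (Z : Finset (Fin (2 * k))), Z.card ≤ 1 ∧
      (∀ v ∈ Z, |dev k E t A v| ≤ 10 * k) ∧
      (∀ u v, u ∉ Z → v ∉ Z → dev k E t A v < dev k E t A u → σ u < σ v) ∧
      ∀ v, ¬ (E / 2 ∈ labelSet (2 * k) t v ∧ E / 2 + 1 ∈ labelSet (2 * k) t v) ∨
        (E / 2 + 2 ∉ labelSet (2 * k) t v ∧ (σ v : ℕ) = 0) ∨
        (1 ≤ E / 2 ∧ E / 2 - 1 ∉ labelSet (2 * k) t v ∧ (σ v : ℕ) + 1 = 2 * k) := by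
  by_cases hex : ∃ v0, E / 2 ∈ labelSet (2 * k) t v0 ∧ E / 2 + 1 ∈ labelSet (2 * k) t v0
  swap
  · obtain ⟨σ, hσ⟩ := sort_perm (fun v => - dev k E t A v)
    refine ⟨σ, ∅, by simp, by simp, fun u v _ _ h => hσ u v (by simpa using h), fun v => Or.inl ?_⟩
    exact fun h => hex ⟨v, h⟩
  obtain ⟨v0, hx, hx1⟩ := hex
  obtain ⟨e1, he1, ht1⟩ := mem_labelSet.1 hx
  obtain ⟨e2, he2, ht2⟩ := mem_labelSet.1 hx1
  have hnd1 := (mem_inc.1 he1).2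
  have hnd2 := (mem_inc.1 he2).2
  have hpos := D.pos e1 hnd1
  have hk2 : 2 ≤ k := by
    by_contra h
    have := hE1 (by omega)
    omega
  have hne : e1 ≠ e2 := by
    rintro rfl
    omega
  have hhs := handshake A D.nd
  have hak : k ≤ A.card := by
    have : ∑ _v : Fin (2 * k), 1 ≤ ∑ v, (incEdges (2 * k) v ∩ A).card :=
      Finset.sum_le_sum fun v _ => by rcases D.deg v with h | h <;> omega
    simp at this
    omega
  have hA1 : e1 ∈ A := (D.mem e1 hnd1).2 (by omega)
  have hA2 : e2 ∈ A := (D.mem e2 hnd2).2 (by omega)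
  have hi1 : e1 ∈ incEdges (2 * k) v0 ∩ A := Finset.mem_inter.2 ⟨he1, hA1⟩
  have hi2 : e2 ∈ incEdges (2 * k) v0 ∩ A := Finset.mem_inter.2 ⟨he2, hA2⟩
  have hd3 : (incEdges (2 * k) v0 ∩ A).card = 3 := by
    rcases D.deg v0 with h | h
    · exact absurd (Finset.card_le_one.1 h.le e1 hi1 e2 hi2) hne
    · exact h
  have hak1 : k < A.card := by
    have : ∑ _v : Fin (2 * k), 1 < ∑ v, (incEdges (2 * k) v ∩ A).card :=
      Finset.sum_lt_sum (fun v _ => by rcases D.deg v with h | h <;> omega)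
        ⟨v0, Finset.mem_univ _, by omega⟩
    simp at this
    omega
  have hpar := D.par
  have ha4 : 4 ≤ A.card := by omega
  have hdev0 : |dev k E t A v0| ≤ 10 * k := by
    have h1 := abs_le.1 (dev_split D v0 e1 hi1)
    have h2 := abs_le.1 (dev_split D v0 e2 hi2)
    have h3 : sh (E / 2) (2 * k) (t e1) = E / 2 := by simp [sh, ht1]
    have h4 : sh (E / 2) (2 * k) (t e2) = E / 2 + 1 + 2 * k := by simp [sh, ht2]
    rw [h3] at h1
    rw [h4] at h2
    rw [abs_le]
    push_cast at *
    constructor <;> omega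
  have hother : ∀ v, v ≠ v0 →
      ¬ (E / 2 ∈ labelSet (2 * k) t v ∧ E / 2 + 1 ∈ labelSet (2 * k) t v) := by
    rintro v hv ⟨h1, h2⟩
    obtain ⟨d1, hd1, hl1⟩ := mem_labelSet.1 h1
    obtain ⟨d2, hd2, hl2⟩ := mem_labelSet.1 h2
    obtain rfl := D.inj d1 e1 (mem_inc.1 hd1).2 hnd1 (by omega)
    obtain rfl := D.inj d2 e2 (mem_inc.1 hd2).2 hnd2 (by omega)
    have a1 := (Sym2.mem_and_mem_iff hv).1 ⟨(mem_inc.1 hd1).1, (mem_inc.1 he1).1⟩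
    have a2 := (Sym2.mem_and_mem_iff hv).1 ⟨(mem_inc.1 hd2).1, (mem_inc.1 he2).1⟩
    exact hne (a1.trans a2.symm)
  by_cases h2 : E / 2 + 2 ∈ labelSet (2 * k) t v0
  · have hm1 : E / 2 - 1 ∉ labelSet (2 * k) t v0 := by
      intro hm
      have hsub : Finset.Icc (E / 2 - 1) (E / 2 + 2) ⊆ (incEdges (2 * k) v0 ∩ A).image t := by
        intro y hy
        rw [Finset.mem_Icc] at hy
        have hyS : y ∈ labelSet (2 * k) t v0 := by
          obtain h | h | h | h : y = E / 2 - 1 ∨ y = E / 2 ∨ y = E / 2 + 1 ∨ y = E / 2 + 2 := by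
            omega
          all_goals rw [h]; assumption
        obtain ⟨e, he, rfl⟩ := mem_labelSet.1 hyS
        refine Finset.mem_image_of_mem t (Finset.mem_inter.2 ⟨he, ?_⟩)
        exact (D.mem e (mem_inc.1 he).2).2 (by omega)
      have := (Finset.card_le_card hsub).trans Finset.card_image_le
      rw [Nat.card_Icc, hd3] at this
      omega
    obtain ⟨σ, h0, hσ⟩ := sort_last (fun v => - dev k E t A v) v0
    refine ⟨σ, {v0}, by simp, by simpa using hdev0, fun u v hu hv h => ?_, fun v => ?_⟩
    · exact hσ u v (by simpa using hu) (by simpa using hv) (by simpa using h)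
    · by_cases hv : v = v0
      · subst hv
        exact Or.inr (Or.inr ⟨by omega, hm1, h0⟩)
      · exact Or.inl (hother v hv)
  · obtain ⟨σ, h0, hσ⟩ := sort_first (fun v => - dev k E t A v) v0
    refine ⟨σ, {v0}, by simp, by simpa using hdev0, fun u v hu hv h => ?_, fun v => ?_⟩
    · exact hσ u v (by simpa using hu) (by simpa using hv) (by simpa using h)
    · by_cases hv : v = v0
      · subst hv
        exact Or.inr (Or.inl ⟨h2, h0⟩)
      · exact Or.inl (hother v hv)

theorem main_ext (k : ℕ) (hk : 0 < k) (t : Sym2 (Fin (2 * k)) → ℕ)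
    (ht : AstrayGood (2 * k) 3 t) :
    ∃ t' : Sym2 (Fin (2 * k + 1)) → ℕ, AlmostSupermagic (2 * k + 1) (7 * (2 * k + 1)) t' ∧
      ∀ p m ℓ : ℕ, 4 * p + 1 ≤ 2 * k + 1 → 0 < m → LabelingHasType (2 * k) p m ℓ t →
        LabelingHasType (2 * k + 1) p (max m 2) ℓ t' := by
  obtain ⟨hE, hE2, hE1⟩ := eps_facts k hk
  obtain ⟨A, D⟩ := data_of_astray hk t ht
  obtain ⟨σ, Z, hZ1, hZ, hσ, hv⟩ := choose_perm hk hE2 hE1 D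
  obtain ⟨t', h1, h2⟩ := ext_exists (fun e => sh (eps (2 * k) / 2) (2 * k) (t e))
    (fun v => eps (2 * k) / 2 + 1 + σ v)
  refine ⟨t', ⟨?_, ?_⟩, ?_⟩
  · exact ext_labeling t ht.1 hE _ (Nat.div_le_self _ _) σ t' h1 h2
  · have key : ∀ u : Fin (2 * k + 1),
        |2 * labelSum (2 * k + 1) t' u - 2 * k * (eps (2 * k) + 2 * k + 1)| ≤ 14 * k + 7 := by
      intro u
      induction u using Fin.lastCases with
      | last =>
        rw [sum_last _ σ t' h2]
        have hx : ∃ r : ℤ, 0 ≤ r ∧ r ≤ 1 ∧ ((eps (2 * k) / 2 : ℕ) : ℤ) * 2 = eps (2 * k) - r :=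
          ⟨(eps (2 * k) % 2 : ℕ), by omega, by omega, by omega⟩
        obtain ⟨r, hr0, hr1, hr⟩ := hx
        have : ((2 * k : ℕ) : ℤ) * (2 * ((eps (2 * k) / 2 : ℕ) : ℤ) + (2 * k : ℕ) + 1) -
            2 * k * (eps (2 * k) + 2 * k + 1) = - (2 * k * r) := by
          push_cast at *
          linear_combination (2 * (k : ℤ)) * hr
        rw [this, abs_le]
        constructor <;> nlinarith
      | cast v =>
        rw [sum_cast t _ σ t' h1 h2 v, mul_add, sum_formula hk D v]
        convert sum_bound D σ Z hZ1 hZ hσ v using 2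
        ring
    intro u v
    have hu := abs_le.1 (key u)
    have hv := abs_le.1 (key v)
    rw [abs_le]
    push_cast
    constructor <;> linarith
  · intro p m ℓ hn hm hty u
    induction u using Fin.lastCases with
    | last =>
      have hl := type_le_card p m ℓ _ (hty ⟨0, by omega⟩)
      have hl2 : (labelSet (2 * k) t ⟨0, by omega⟩).card ≤ 2 * k - 1 := by
        rw [← card_inc (⟨0, by omega⟩ : Fin (2 * k))]
        exact Finset.card_image_le
      exact type_Icc p _ ℓ _ _ (by omega) (by omega) (by omega) (by omega) _
        (set_last _ σ t' h2)
    | cast v =>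
      refine type_mono p m _ ℓ _ (le_max_left _ _) ?_
      rw [set_cast t _ σ t' h1 h2 v]
      have hold : ∀ y ∈ labelSet (2 * k) t v, sh (eps (2 * k) / 2) (2 * k) y ∈
          insert (eps (2 * k) / 2 + 1 + (σ v : ℕ))
            ((labelSet (2 * k) t v).image (sh (eps (2 * k) / 2) (2 * k))) := fun y hy =>
        Finset.mem_insert_of_mem (Finset.mem_image_of_mem _ hy)
      rcases hv v with h | ⟨h, h0⟩ | ⟨hx, h, h0⟩
      · exact type_transfer p m ℓ _ (2 * k) _ _ h hold (hty v)
      · refine type_transfer p m ℓ (eps (2 * k) / 2 + 1) (2 * k) _ _ (fun h' => h h'.2)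
          (fun y hy => ?_) (hty v)
        by_cases hy' : y = eps (2 * k) / 2 + 1
        · rw [hy', h0]
          simp [sh]
        · convert hold y hy using 1
          unfold sh
          split_ifs <;> omega
      · refine type_transfer p m ℓ (eps (2 * k) / 2 - 1) (2 * k) _ _ (fun h' => h h'.1)
          (fun y hy => ?_) (hty v)
        by_cases hy' : y = eps (2 * k) / 2
        · refine Finset.mem_insert.2 (Or.inl ?_)
          rw [hy']
          unfold sh
          split_ifs <;> omega
        · convert hold y hy using 1
          unfold sh
          split_ifs <;> omega

end Swap

theorem stmt16 (k p m ℓ : ℕ) (hk : 0 < k) (hp : 0 < p) (hm : 0 < m) (hℓ : 0 < ℓ)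
    (t : Sym2 (Fin (2 * k)) → ℕ) (ht : Swap.AstrayGood (2 * k) 3 t) :
    (∃ t' : Sym2 (Fin (2 * k + 1)) → ℕ,
      Swap.AlmostSupermagic (2 * k + 1) (7 * (2 * k + 1)) t') ∧
    (4 * p + 1 ≤ 2 * k + 1 → Swap.LabelingHasType (2 * k) p m ℓ t →
      ∃ t' : Sym2 (Fin (2 * k + 1)) → ℕ,
        Swap.AlmostSupermagic (2 * k + 1) (7 * (2 * k + 1)) t' ∧
        Swap.LabelingHasType (2 * k + 1) p (max m 2) ℓ t') := by
  obtain ⟨t', h1, h2⟩ := Swap.main_ext k hk t ht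
  exact ⟨⟨t', h1⟩, fun hn hty => ⟨t', h1, h2 p m ℓ hn hm hty⟩⟩
end
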